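/- arXiv:2104.11429 — 5 statements merged into one kernel-verified Lean document; each statement's English description precedes it below -/
import Mathlib

section
/- Let M be a two-dimensional, complete, non-compact Riemannian manifold which is rotationally symmetric about a point p ∈ M, and suppose M is parabolic (conformally equivalent to the Euclidean plane). Then for every q ∈ M with q ≠ p and every λ > 1, the set B_∞ of the growth competition between p and q is a bounded subset of M. -/
/-!
Formalization framework for "growth competitions" (after the paper's
Section 2), at the metric-space level.

Since Mathlib does not yet have Riemannian metrics, a complete Riemannian
manifold is represented by a proper (hence complete; Hopf-Rinow) metric
space whose distance is the induced length (intrinsic) metric, and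
spherical symmetry about `p` with warping function `G` is expressed through
global geodesic polar normal coordinates `Φ : ℝⁿ ≃ M` with `Φ 0 = p` and
`dist (Φ x) p = ‖x‖`, in which the Riemannian distance is the infimum of
lengths of Lipschitz curves measured in the warped metric
`g = dr² + G(r)² dθ²`.
-/

open Set Metric Filter MeasureTheory InnerProductGeometry NNReal ENNReal
open scoped RealInnerProductSpace Classical

noncomputable section

namespace GrowthComp

variable {M : Type*} [MetricSpace M]

/-- Length of the path `γ : ℝ → M` over the time interval `[0, T]`
(the total variation of `γ` on `[0, T]`, valued in `ℝ≥0∞`). -/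
def pathLength (γ : ℝ → M) (T : ℝ) : ℝ≥0∞ := eVariationOn γ (Set.Icc 0 T)

/-- The intrinsic metric `d_S` of `M ∖ S`: the infimum of lengths of Lipschitz
paths from `x` to `y` avoiding `S` (with `sInf ∅ = ∞`). -/
def dCompl (S : Set M) (x y : M) : ℝ≥0∞ :=
  sInf {L : ℝ≥0∞ | ∃ (T : ℝ) (γ : ℝ → M), 0 ≤ T ∧ γ 0 = x ∧ γ T = y ∧
    (∃ K : ℝ≥0, LipschitzOnWith K γ (Set.Icc 0 T)) ∧
    (∀ t ∈ Set.Icc 0 T, γ t ∉ S) ∧ L = pathLength γ T}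

/-- The distance of `M` is the induced length metric (true for every
complete Riemannian manifold). -/
def IsLengthSpace (M : Type*) [MetricSpace M] : Prop :=
  ∀ x y : M, ENNReal.ofReal (dist x y) = dCompl (∅ : Set M) x y

/-- A path `γ : [0, T] → M` *avoids* the (time-indexed) family `B`:
it starts at `q`, is `λ`-Lipschitz, and `γ s ∉ B s` for all `s ∈ [0, T]`. -/
def AvoidsB (q : M) (lam : ℝ) (B : ℝ → Set M) (T : ℝ) (γ : ℝ → M) : Prop :=
  γ 0 = q ∧ LipschitzOnWith (Real.toNNReal lam) γ (Set.Icc 0 T) ∧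
    ∀ s ∈ Set.Icc 0 T, γ s ∉ B s

/-- A path `η : [0, T] → M` *avoids* the family `A`:
it starts at `p`, is `1`-Lipschitz, and `η s ∉ A s` for all `s ∈ [0, T]`. -/
def AvoidsA (p : M) (A : ℝ → Set M) (T : ℝ) (η : ℝ → M) : Prop :=
  η 0 = p ∧ LipschitzOnWith 1 η (Set.Icc 0 T) ∧ ∀ s ∈ Set.Icc 0 T, η s ∉ A s

/-- `{A_t, B_t}_{t ≥ 0}` is a *growth competition* between `p` and `q` with
speed ratio `λ`: both families are increasing, `A 0 = {q}`, `B 0 = {p}`, and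
for `t > 0`, `A t` is the union of `γ([0,t])` over paths `γ` avoiding `B`
and `B t` is the union of `η([0,t))` over paths `η` avoiding `A`. -/
structure IsGrowthCompetition (p q : M) (lam : ℝ) (A B : ℝ → Set M) : Prop where
  monoA : ∀ ⦃t₁ t₂ : ℝ⦄, 0 ≤ t₁ → t₁ ≤ t₂ → A t₁ ⊆ A t₂
  monoB : ∀ ⦃t₁ t₂ : ℝ⦄, 0 ≤ t₁ → t₁ ≤ t₂ → B t₁ ⊆ B t₂
  A_zero : A 0 = {q}
  B_zero : B 0 = {p}
  A_eq : ∀ t : ℝ, 0 < t →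
    A t = {x | ∃ γ : ℝ → M, AvoidsB q lam B t γ ∧ x ∈ γ '' Set.Icc 0 t}
  B_eq : ∀ t : ℝ, 0 < t →
    B t = {x | ∃ η : ℝ → M, AvoidsA p A t η ∧ x ∈ η '' Set.Ico 0 t}

/-- `A_∞ = ⋃_{t ≥ 0} A_t`. -/
def Ainfty (A : ℝ → Set M) : Set M := ⋃ t ∈ Set.Ici (0 : ℝ), A t

/-- `B_∞ = ⋃_{t ≥ 0} B_t`. -/
def Binfty (B : ℝ → Set M) : Set M := ⋃ t ∈ Set.Ici (0 : ℝ), B t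

/-- The recursively defined sets `Ω_n`:
`Ω_0 = ∅`, `Ω_{n+1} = Ω_n ∪ {x ∈ M ∖ Ω_n | d_{Ω_n}(x, q) > λ d(x, p)}`. -/
def OmegaSeq (p q : M) (lam : ℝ) : ℕ → Set M
  | 0 => ∅
  | n + 1 => OmegaSeq p q lam n ∪
      {x | x ∉ OmegaSeq p q lam n ∧
        ENNReal.ofReal (lam * dist x p) < dCompl (OmegaSeq p q lam n) x q}

/-- `Ω = ⋃_{n ≥ 1} Ω_n`. -/
def Omega (p q : M) (lam : ℝ) : Set M := ⋃ n : ℕ, OmegaSeq p q lam (n + 1)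

/-- `γ` is a unit-speed minimizing geodesic from `x` to `y`, parametrized on
`[0, dist x y]`. -/
def IsMinGeodesicFromTo (γ : ℝ → M) (x y : M) : Prop :=
  γ 0 = x ∧ γ (dist x y) = y ∧
    ∀ s ∈ Set.Icc (0 : ℝ) (dist x y), ∀ t ∈ Set.Icc (0 : ℝ) (dist x y),
      dist (γ s) (γ t) = |s - t|

/-- `S` is star-shaped about `p`: every minimizing geodesic from `p` to a
point of `S` lies inside `S`. -/
def StarShapedAbout (p : M) (S : Set M) : Prop :=
  ∀ x ∈ S, ∀ γ : ℝ → M, IsMinGeodesicFromTo γ p x →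
    ∀ t ∈ Set.Icc (0 : ℝ) (dist p x), γ t ∈ S

/-- `x` is *visible* from `q` through the obstacle `S`: no minimizing
geodesic joining `q` and `x` intersects `S`.  (On a nonpositively curved
simply connected manifold minimizing geodesics are unique, so this matches
"the minimizing geodesic joining `q` and `x` does not intersect `S`".) -/
def VisibleThrough (S : Set M) (q x : M) : Prop :=
  ∀ γ : ℝ → M, IsMinGeodesicFromTo γ q x →
    ∀ t ∈ Set.Icc (0 : ℝ) (dist q x), γ t ∉ S

/-! ### Spherically symmetric manifolds, via polar normal coordinates -/

/-- Euclidean `n`-space, the model space for polar normal coordinates. -/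
abbrev Euc (n : ℕ) : Type := EuclideanSpace ℝ (Fin n)

/-- The norm of the tangent vector `v` at the point `x ∈ ℝⁿ ∖ {0}` in the
spherically symmetric (warped product) metric `g = dr² + G(r)² dθ²`:
`g_x(v,v) = ⟨v, x̂⟩² + (G(‖x‖)²/‖x‖²) (‖v‖² − ⟨v, x̂⟩²)`. -/
def warpNorm {n : ℕ} (G : ℝ → ℝ) (x v : Euc n) : ℝ :=
  if x = 0 then ‖v‖
  else Real.sqrt (⟪v, ‖x‖⁻¹ • x⟫ ^ 2 +
    (G ‖x‖ / ‖x‖) ^ 2 * (‖v‖ ^ 2 - ⟪v, ‖x‖⁻¹ • x⟫ ^ 2))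

/-- The length of a (Lipschitz, hence a.e. differentiable) curve `c` on
`[0, T]` in the warped metric `dr² + G(r)² dθ²`. -/
def warpLength {n : ℕ} (G : ℝ → ℝ) (c : ℝ → Euc n) (T : ℝ) : ℝ≥0∞ :=
  ∫⁻ t in Set.Icc (0 : ℝ) T, ENNReal.ofReal (warpNorm G (c t) (deriv c t))

/-- `G` is an admissible warping function: positive and smooth on `(0,∞)`,
with `G(r) → 0` and `G(r)/r → 1` as `r → 0⁺`. -/
def IsWarping (G : ℝ → ℝ) : Prop :=
  (∀ r : ℝ, 0 < r → 0 < G r) ∧ ContDiffOn ℝ (⊤ : ℕ∞) G (Set.Ioi 0) ∧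
    Tendsto G (nhdsWithin 0 (Set.Ioi 0)) (nhds 0) ∧
    Tendsto (fun r => G r / r) (nhdsWithin 0 (Set.Ioi 0)) (nhds 1)

/-- `Φ : ℝⁿ ≃ M` realizes `M` as spherically symmetric about `p` with
warping function `G`: `Φ` is a global geodesic polar normal coordinate
chart — `Φ 0 = p` and the radial coordinate is the distance to `p` — and
the Riemannian distance of `M` is the infimum of warped lengths of
Lipschitz curves computed in the chart. -/
def IsSphericallySymmetric {n : ℕ} (p : M) (G : ℝ → ℝ) (Φ : Euc n ≃ M) : Prop :=
  IsWarping G ∧ Φ 0 = p ∧ (∀ x : Euc n, dist (Φ x) p = ‖x‖) ∧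
    ∀ x y : Euc n, ENNReal.ofReal (dist (Φ x) (Φ y)) =
      sInf {L : ℝ≥0∞ | ∃ (T : ℝ) (c : ℝ → Euc n), 0 ≤ T ∧ c 0 = x ∧ c T = y ∧
        (∃ K : ℝ≥0, LipschitzOnWith K c (Set.Icc 0 T)) ∧ L = warpLength G c T}

/-- The angular polar coordinate `θ(x) ∈ S_pM ≅ S^{n-1}` of a point
`x ≠ p`, read off through the polar chart `Φ`. -/
def polarTheta {n : ℕ} {M : Type*} [MetricSpace M] (Φ : Euc n ≃ M) (x : M) : Euc n :=
  ‖Φ.symm x‖⁻¹ • Φ.symm x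

/-- Nonpositive sectional curvature for the spherically symmetric metric
`dr² + G(r)² dθ²`: the radial sectional curvature is `−G''/G ≤ 0`,
i.e. `G` is convex, and the tangential one is `(1 − G'²)/G² ≤ 0`,
i.e. `G' ≥ 1`. -/
def NonposCurvWarping (G : ℝ → ℝ) : Prop :=
  ConvexOn ℝ (Set.Ioi 0) G ∧ ∀ r : ℝ, 0 < r → 1 ≤ deriv G r

/-- `∫₁^∞ dr / G(r) = ∞`.  For a surface of revolution this is, by a theorem
of Milnor cited in the paper, equivalent to parabolicity, i.e. conformal
equivalence to the Euclidean plane. -/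
def ParabolicWarping (G : ℝ → ℝ) : Prop :=
  ∫⁻ r in Set.Ici (1 : ℝ), ENNReal.ofReal ((G r)⁻¹) = ⊤

/-- `∫₁^∞ dr / G(r) < ∞`.  For a surface of revolution this is, by a theorem
of Milnor cited in the paper, equivalent to hyperbolicity, i.e. conformal
equivalence to the hyperbolic plane. -/
def HyperbolicWarping (G : ℝ → ℝ) : Prop :=
  ∫⁻ r in Set.Ici (1 : ℝ), ENNReal.ofReal ((G r)⁻¹) < ⊤

variable {n : ℕ} {p : M} {G : ℝ → ℝ}

/-- A bound on the warped speed of a `C¹` curve bounds the distance between its endpoints. -/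
lemma IsSphericallySymmetric.dist_le_of_warpNorm_le {Φ : Euc n ≃ M}
    (hsym : IsSphericallySymmetric p G Φ) {c : ℝ → Euc n} (hc : ContDiff ℝ 1 c) {a b C : ℝ}
    (hab : a ≤ b) (hC : 0 ≤ C) (h : ∀ t ∈ Icc a b, warpNorm G (c t) (deriv c t) ≤ C) :
    dist (Φ (c a)) (Φ (c b)) ≤ C * (b - a) := by
  have hshift : ContDiff ℝ 1 fun t => c (a + t) := hc.comp (contDiff_const.add contDiff_id)
  obtain ⟨K, hK⟩ := (hshift.locallyLipschitz.locallyLipschitzOn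
    (s := Icc 0 (b - a))).exists_lipschitzOnWith_of_compact isCompact_Icc
  rw [← ENNReal.ofReal_le_ofReal_iff (mul_nonneg hC (sub_nonneg.2 hab)), hsym.2.2.2]
  refine le_trans (sInf_le ?_) (?_ : warpLength G (fun t => c (a + t)) (b - a) ≤ _)
  · exact ⟨b - a, fun t => c (a + t), sub_nonneg.2 hab, by simp, by simp, ⟨K, hK⟩, rfl⟩
  calc warpLength G (fun t => c (a + t)) (b - a)
      ≤ ∫⁻ _ in Icc (0 : ℝ) (b - a), ENNReal.ofReal C := by
        refine setLIntegral_mono measurable_const fun t ht => ENNReal.ofReal_le_ofReal ?_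
        rw [deriv_comp_const_add]
        exact h _ ⟨by linarith [ht.1], by linarith [ht.2]⟩
    _ = ENNReal.ofReal (C * (b - a)) := by
        rw [setLIntegral_const, Real.volume_Icc, sub_zero, ENNReal.ofReal_mul hC]

lemma IsWarping.continuousOn (hG : IsWarping G) : ContinuousOn G (Ioi 0) := hG.2.1.continuousOn

/-- The ratio `G r / r` is bounded on bounded subsets of `(0, ∞)`. -/
lemma IsWarping.exists_div_le (hG : IsWarping G) (R : ℝ) :
    ∃ K : ℝ, 1 ≤ K ∧ ∀ r, 0 < r → r ≤ R → G r / r ≤ K := by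
  have hev : ∀ᶠ r in nhdsWithin (0 : ℝ) (Ioi 0), G r / r < 2 :=
    hG.2.2.2.eventually (gt_mem_nhds (by norm_num))
  obtain ⟨δ, hδ, hδ'⟩ := mem_nhdsGT_iff_exists_Ioo_subset.1 hev
  have hδ0 : (0 : ℝ) < δ := hδ
  have hcont : ContinuousOn (fun r => G r / r) (Icc δ R) := by
    refine (hG.continuousOn.mono fun r hr => hδ0.trans_le hr.1).div continuousOn_id
      fun r hr => (hδ0.trans_le hr.1).ne'
  obtain ⟨K, hK⟩ := (isCompact_Icc.image_of_continuousOn hcont).bddAbove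
  refine ⟨max 2 K, le_max_of_le_left (by norm_num), fun r hr hrR => ?_⟩
  rcases lt_or_ge r δ with h | h
  · exact le_max_of_le_left (le_of_lt (hδ' ⟨hr, h⟩))
  · exact le_max_of_le_right (hK ⟨r, ⟨h, hrR⟩, rfl⟩)

lemma warpNorm_le_mul_norm {x v : Euc n} {K : ℝ} (hK : 1 ≤ K) (hG : 0 ≤ G ‖x‖)
    (hx : G ‖x‖ / ‖x‖ ≤ K) : warpNorm G x v ≤ K * ‖v‖ := by
  have hK0 : 0 ≤ K := by linarith
  unfold warpNorm
  split_ifs with h0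
  · exact le_mul_of_one_le_left (norm_nonneg _) hK
  · refine Real.sqrt_le_iff.2 ⟨by positivity, ?_⟩
    have hx0 : ‖x‖ ≠ 0 := norm_ne_zero_iff.2 h0
    set i := ⟪v, ‖x‖⁻¹ • x⟫ with hi
    have h1 : |i| ≤ ‖v‖ := by
      have := abs_real_inner_le_norm v (‖x‖⁻¹ • x)
      rwa [norm_smul, norm_inv, norm_norm, inv_mul_cancel₀ hx0, mul_one] at this
    have h2 : i ^ 2 ≤ ‖v‖ ^ 2 := sq_le_sq' (abs_le.1 h1).1 (abs_le.1 h1).2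
    have h3 : (G ‖x‖ / ‖x‖) ^ 2 ≤ K ^ 2 := pow_le_pow_left₀ (by positivity) hx 2
    nlinarith [mul_le_mul_of_nonneg_right h3 (sub_nonneg.2 h2), sq_nonneg i,
      mul_nonneg (sub_nonneg.2 (one_le_pow₀ hK : 1 ≤ K ^ 2)) (sq_nonneg i)]

/-- The polar chart is continuous. -/
lemma IsSphericallySymmetric.continuous {Φ : Euc n ≃ M} (hsym : IsSphericallySymmetric p G Φ) :
    Continuous Φ := by
  refine continuous_iff_continuousAt.2 fun z => ?_
  set R := ‖z‖ + 1 with hR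
  obtain ⟨K, hK1, hK⟩ := hsym.1.exists_div_le R
  have hlip : LipschitzOnWith K.toNNReal Φ (closedBall 0 R) := by
    refine LipschitzOnWith.of_dist_le_mul fun x hx y hy => ?_
    rw [Real.coe_toNNReal K (by linarith)]
    have hderiv : ∀ t : ℝ, HasDerivAt (AffineMap.lineMap x y : ℝ → Euc n) (y - x) t :=
      fun t => AffineMap.hasDerivAt_lineMap
    have hc : ContDiff ℝ 1 (AffineMap.lineMap x y : ℝ → Euc n) := by
      simp only [AffineMap.coe_lineMap, vsub_eq_sub, vadd_eq_add]
      fun_prop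
    have := hsym.dist_le_of_warpNorm_le hc zero_le_one (C := K * ‖y - x‖) (by positivity)
      fun t ht => by
        rw [(hderiv t).deriv]
        have hmem : AffineMap.lineMap x y t ∈ closedBall (0 : Euc n) R :=
          (convex_closedBall _ _).lineMap_mem hx hy ht
        rw [mem_closedBall_zero_iff] at hmem
        rcases (norm_nonneg (AffineMap.lineMap x y t : Euc n)).eq_or_lt with h0 | h0
        · rw [warpNorm, if_pos (norm_eq_zero.1 h0.symm)]
          exact le_mul_of_one_le_left (norm_nonneg _) hK1
        · exact warpNorm_le_mul_norm hK1 (hsym.1.1 _ h0).le (hK _ h0 hmem)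
    simpa [dist_eq_norm, norm_sub_rev] using this
  exact hlip.continuousOn.continuousAt (closedBall_mem_nhds_of_mem (by simp [hR]))

/-- The inverse of the polar chart is continuous. -/
lemma IsSphericallySymmetric.continuous_symm {Φ : Euc n ≃ M}
    (hsym : IsSphericallySymmetric p G Φ) : Continuous Φ.symm := by
  have hprop : Tendsto Φ (Bornology.cobounded (Euc n)) (Bornology.cobounded M) := by
    rw [← tendsto_dist_right_atTop_iff p]
    simpa only [hsym.2.2.1] using tendsto_norm_cobounded_atTop
  have hclosed : IsClosedMap Φ := by
    refine (isProperMap_iff_tendsto_cocompact.2 ⟨hsym.continuous, ?_⟩).isClosedMap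
    rw [← cobounded_eq_cocompact]
    exact hprop.trans cobounded_le_cocompact
  exact (Φ.toHomeomorphOfContinuousClosed hsym.continuous hclosed).symm.continuous

/-- The curve `s ↦ (s, F s)` in the polar coordinates of the plane spanned by `e₁` and `e₂`. -/
def polarCurve (e₁ e₂ : Euc n) (F : ℝ → ℝ) (s : ℝ) : Euc n :=
  s • (Real.cos (F s) • e₁ + Real.sin (F s) • e₂)

section PolarCurve

variable {e₁ e₂ : Euc n} {F f : ℝ → ℝ}

lemma hasDerivAt_polarCurve {s : ℝ} (hF : HasDerivAt F (f s) s) :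
    HasDerivAt (polarCurve e₁ e₂ F)
      ((Real.cos (F s) - s * (Real.sin (F s) * f s)) • e₁ +
        (Real.sin (F s) + s * (Real.cos (F s) * f s)) • e₂) s := by
  have h := (hasDerivAt_id s).smul ((hF.cos.smul_const e₁).add (hF.sin.smul_const e₂))
  refine h.congr_deriv ?_
  simp only [id, Pi.add_apply]
  module

lemma contDiff_polarCurve (hF : ∀ s, HasDerivAt F (f s) s) (hf : Continuous f) :
    ContDiff ℝ 1 (polarCurve e₁ e₂ F) := by
  have h1 : ContDiff ℝ 1 F := contDiff_one_iff_deriv.2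
    ⟨fun s => (hF s).differentiableAt, by rwa [funext fun s => (hF s).deriv]⟩
  unfold polarCurve
  fun_prop

lemma inner_smul_add_smul (h₁ : ‖e₁‖ = 1) (h₂ : ‖e₂‖ = 1) (h₁₂ : ⟪e₁, e₂⟫ = 0) (a b a' b' : ℝ) :
    ⟪a • e₁ + b • e₂, a' • e₁ + b' • e₂⟫ = a * a' + b * b' := by
  simp only [inner_add_left, inner_add_right, inner_smul_left, inner_smul_right,
    real_inner_self_eq_norm_sq, h₁, h₂, h₁₂, real_inner_comm e₁ e₂, RCLike.conj_to_real]
  ring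

lemma norm_polarCurve (h₁ : ‖e₁‖ = 1) (h₂ : ‖e₂‖ = 1) (h₁₂ : ⟪e₁, e₂⟫ = 0) {s : ℝ} (hs : 0 ≤ s) :
    ‖polarCurve e₁ e₂ F s‖ = s := by
  have h : ‖Real.cos (F s) • e₁ + Real.sin (F s) • e₂‖ = 1 := by
    rw [← sq_eq_sq₀ (norm_nonneg _) zero_le_one, ← real_inner_self_eq_norm_sq,
      inner_smul_add_smul h₁ h₂ h₁₂]
    nlinarith [Real.sin_sq_add_cos_sq (F s)]
  rw [polarCurve, norm_smul, h, mul_one, Real.norm_of_nonneg hs]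

lemma warpNorm_polarCurve (h₁ : ‖e₁‖ = 1) (h₂ : ‖e₂‖ = 1) (h₁₂ : ⟪e₁, e₂⟫ = 0) {s : ℝ}
    (hs : 0 < s) (hF : HasDerivAt F (f s) s) :
    warpNorm G (polarCurve e₁ e₂ F s) (deriv (polarCurve e₁ e₂ F) s) =
      Real.sqrt (1 + (G s * f s) ^ 2) := by
  have hn := norm_polarCurve (F := F) h₁ h₂ h₁₂ hs.le
  have h0 : polarCurve e₁ e₂ F s ≠ 0 := by
    rw [← norm_ne_zero_iff, hn]; exact hs.ne'
  rw [warpNorm, if_neg h0, hn, (hasDerivAt_polarCurve hF).deriv, polarCurve,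
    inv_smul_smul₀ hs.ne', ← real_inner_self_eq_norm_sq, inner_smul_add_smul h₁ h₂ h₁₂,
    inner_smul_add_smul h₁ h₂ h₁₂]
  congr 1
  have hcs := Real.sin_sq_add_cos_sq (F s)
  set S := Real.sin (F s)
  set C := Real.cos (F s)
  have e1 : (C - s * (S * f s)) * C + (S + s * (C * f s)) * S = 1 := by linear_combination hcs
  have e2 : (C - s * (S * f s)) * (C - s * (S * f s)) + (S + s * (C * f s)) * (S + s * (C * f s))
      = 1 + (s * f s) ^ 2 := by linear_combination (1 + (s * f s) ^ 2) * hcs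
  rw [e1, e2]
  field_simp
  ring

end PolarCurve

/-- Rotation of the plane by a quarter turn. -/
def quarterTurn (x : Euc 2) : Euc 2 := !₂[-x 1, x 0]

lemma norm_quarterTurn (x : Euc 2) : ‖quarterTurn x‖ = ‖x‖ := by
  simp [quarterTurn, EuclideanSpace.norm_eq, Fin.sum_univ_two, add_comm]

lemma inner_quarterTurn_self (x : Euc 2) : ⟪x, quarterTurn x⟫ = 0 := by
  simp [quarterTurn, PiLp.inner_apply, Fin.sum_univ_two]
  ring

/-- A point of the plane at angle `φ` from `e` is obtained from `e` by a rotation of angle `±φ`. -/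
lemma eq_smul_of_inner_eq {e x : Euc 2} (he : ‖e‖ = 1) {φ : ℝ} (hφ : ⟪x, e⟫ = ‖x‖ * Real.cos φ) :
    x = ‖x‖ • (Real.cos φ • e + Real.sin φ • quarterTurn e) ∨
      x = ‖x‖ • (Real.cos φ • e + Real.sin φ • -quarterTurn e) := by
  have he2 : e 0 ^ 2 + e 1 ^ 2 = 1 := by
    have := EuclideanSpace.norm_sq_eq e
    rw [he, Fin.sum_univ_two] at this
    simpa using this.symm
  have hx2 : ‖x‖ ^ 2 = x 0 ^ 2 + x 1 ^ 2 := by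
    have := EuclideanSpace.norm_sq_eq x
    rw [Fin.sum_univ_two] at this
    simpa using this
  have hin : x 0 * e 0 + x 1 * e 1 = ‖x‖ * Real.cos φ := by
    rw [← hφ]
    simp [PiLp.inner_apply, Fin.sum_univ_two]
    ring
  have hcs := Real.sin_sq_add_cos_sq φ
  have hsq : (x 1 * e 0 - x 0 * e 1) ^ 2 = (‖x‖ * Real.sin φ) ^ 2 := by
    linear_combination (-(x 0 * e 0 + x 1 * e 1) - ‖x‖ * Real.cos φ) * hin
      + (x 0 ^ 2 + x 1 ^ 2) * he2 - hx2 - ‖x‖ ^ 2 * hcs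
  rcases sq_eq_sq_iff_eq_or_eq_neg.1 hsq with h | h
  · left
    ext i
    fin_cases i
    · simp [quarterTurn]
      linear_combination -x 0 * he2 + e 0 * hin - e 1 * h
    · simp [quarterTurn]
      linear_combination -x 1 * he2 + e 1 * hin + e 0 * h
  · right
    ext i
    fin_cases i
    · simp [quarterTurn]
      linear_combination -x 0 * he2 + e 0 * hin - e 1 * h
    · simp [quarterTurn]
      linear_combination -x 1 * he2 + e 1 * hin + e 0 * h

/-- A continuous path from the origin leaving a large disc crosses one of the two polar curves. -/
lemma exists_mem_spiral {e : Euc 2} (he : ‖e‖ = 1) {F : ℝ → ℝ} (hF : Continuous F)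
    (hmono : StrictMono F) {r₀ R : ℝ} (hr₀ : 0 < r₀) (hF0 : F r₀ = 0) (hR : Real.pi ≤ F R)
    {x : ℝ → Euc 2} {T : ℝ} (hT : 0 ≤ T) (hx : ContinuousOn x (Icc 0 T)) (hx0 : x 0 = 0)
    (hxT : R ≤ ‖x T‖) :
    ∃ t ∈ Icc 0 T, r₀ ≤ ‖x t‖ ∧ (x t = polarCurve e (quarterTurn e) F ‖x t‖ ∨
      x t = polarCurve e (-quarterTurn e) F ‖x t‖) := by
  set φ : ℝ → ℝ := fun t => F ‖x t‖ - Real.arccos (⟪x t, e⟫ / max ‖x t‖ r₀) with hφ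
  have hpos : ∀ t, 0 < max ‖x t‖ r₀ := fun t => lt_max_of_lt_right hr₀
  have hcont : ContinuousOn φ (Icc 0 T) := by
    refine (hF.comp_continuousOn hx.norm).sub (Real.continuous_arccos.comp_continuousOn ?_)
    exact (hx.inner continuousOn_const).div (hx.norm.sup continuousOn_const) fun t _ => (hpos t).ne'
  have h0 : φ 0 ≤ 0 := by
    have : F 0 < F r₀ := hmono hr₀
    simp only [hφ, hx0, norm_zero]
    linarith [Real.arccos_nonneg (⟪(0 : Euc 2), e⟫ / max 0 r₀)]
  have hT' : 0 ≤ φ T := by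
    have := hmono.monotone hxT
    simp only [hφ]
    linarith [Real.arccos_le_pi (⟪x T, e⟫ / max ‖x T‖ r₀)]
  obtain ⟨t, ht, hzero⟩ := intermediate_value_Icc hT hcont ⟨h0, hT'⟩
  have heq : F ‖x t‖ = Real.arccos (⟪x t, e⟫ / max ‖x t‖ r₀) := sub_eq_zero.1 hzero
  have hge : r₀ ≤ ‖x t‖ := hmono.le_iff_le.1 (by rw [hF0, heq]; exact Real.arccos_nonneg _)
  have hn : 0 < ‖x t‖ := hr₀.trans_le hge
  refine ⟨t, ht, hge, eq_smul_of_inner_eq he ?_⟩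
  have habs := abs_real_inner_le_norm (x t) e
  rw [he, mul_one] at habs
  rw [heq, max_eq_left hge, Real.cos_arccos]
  · field_simp
  · rw [le_div_iff₀ hn]; linarith [(abs_le.1 habs).1]
  · rw [div_le_one hn]; exact (abs_le.1 habs).2

/-- The angle function of a spiral which moves at speed `√(1 + c²)` in the metric
`dr² + G(r)² dθ²` and whose radial speed is `1`. -/
lemma exists_spiral_angle (hG : IsWarping G) (hpar : ParabolicWarping G) {c r₀ : ℝ} (hc : 0 < c)
    (hr₀ : 0 < r₀) :
    ∃ F f : ℝ → ℝ, Continuous f ∧ (∀ s, HasDerivAt F (f s) s) ∧ StrictMono F ∧ F r₀ = 0 ∧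
      (∀ s, r₀ ≤ s → G s * f s = c) ∧ ∃ R, Real.pi ≤ F R := by
  have hpos : ∀ s, 0 < max s r₀ := fun s => lt_max_of_lt_right hr₀
  set g : ℝ → ℝ := fun s => (G (max s r₀))⁻¹ with hg
  have hg0 : ∀ s, 0 < g s := fun s => inv_pos.2 (hG.1 _ (hpos s))
  have hgc : Continuous g :=
    (hG.continuousOn.comp_continuous (by fun_prop) hpos).inv₀ fun s => (hG.1 _ (hpos s)).ne'
  have hderiv : ∀ s, HasDerivAt (fun s => c * ∫ u in r₀..s, g u) (c * g s) s := fun s =>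
    (hgc.integral_hasStrictDerivAt r₀ s).hasDerivAt.const_mul c
  refine ⟨fun s => c * ∫ u in r₀..s, g u, fun s => c * g s, by fun_prop, hderiv,
    strictMono_of_hasDerivAt_pos hderiv fun s => mul_pos hc (hg0 s), by simp, fun s hs => ?_, ?_⟩
  · have := (hG.1 s (hr₀.trans_le hs)).ne'
    simp only [hg, max_eq_left hs]
    field_simp
  · by_contra! hlt
    have hint : IntegrableOn g (Ioi r₀) := by
      refine integrableOn_Ioi_of_intervalIntegral_norm_bounded (Real.pi / c) r₀ (b := id)
        (l := atTop) (fun i => (hgc.integrableOn_Icc).mono_set Ioc_subset_Icc_self) tendsto_id ?_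
      refine Eventually.of_forall fun i => ?_
      simp only [Real.norm_of_nonneg (hg0 _).le, id]
      rw [le_div_iff₀ hc, mul_comm]
      exact (hlt i).le
    have hint1 : IntegrableOn (fun r => (G r)⁻¹) (Ioi r₀) :=
      hint.congr_fun (fun r hr => by simp only [hg, max_eq_left (le_of_lt (mem_Ioi.1 hr))]) measurableSet_Ioi
    have hint2 : IntegrableOn (fun r => (G r)⁻¹) (Icc 1 r₀) := by
      refine ContinuousOn.integrableOn_Icc (ContinuousOn.inv₀ (hG.continuousOn.mono ?_) ?_)
      · exact fun r hr => zero_lt_one.trans_le hr.1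
      · exact fun r hr => (hG.1 r (zero_lt_one.trans_le hr.1)).ne'
    have hint3 : IntegrableOn (fun r => (G r)⁻¹) (Ici 1) :=
      (hint2.union hint1).mono_set fun r hr => by
        rcases le_or_gt r r₀ with h | h
        exacts [Or.inl ⟨hr, h⟩, Or.inr h]
    exact hint3.lintegral_lt_top.ne hpar

lemma IsGrowthCompetition.dist_lt_of_mem {q : M} {lam : ℝ} {A B : ℝ → Set M}
    (hcomp : IsGrowthCompetition p q lam A B) {t : ℝ} (ht : 0 < t) {x : M} (hx : x ∈ B t) :
    dist x p < t := by
  rw [hcomp.B_eq t ht] at hx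
  obtain ⟨η, ⟨h0, hlip, -⟩, u, hu, rfl⟩ := hx
  have := hlip.dist_le_mul u ⟨hu.1, hu.2.le⟩ 0 ⟨le_rfl, ht.le⟩
  rw [h0, Real.dist_0_eq_abs, abs_of_nonneg hu.1, NNReal.coe_one, one_mul] at this
  exact this.trans_lt hu.2

/-- The faster set contains every `λ`-Lipschitz path from `q` that moves away from `p` at
least at unit speed. -/
lemma IsGrowthCompetition.mem_A_of_le_dist {q : M} (hq : q ≠ p) {lam : ℝ} {A B : ℝ → Set M}
    (hcomp : IsGrowthCompetition p q lam A B) {γ : ℝ → M} {t : ℝ} (ht : 0 < t) (h0 : γ 0 = q)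
    (hlip : LipschitzOnWith lam.toNNReal γ (Icc 0 t)) (hγ : ∀ s ∈ Icc 0 t, s ≤ dist (γ s) p) :
    γ t ∈ A t := by
  rw [hcomp.A_eq t ht]
  refine ⟨γ, ⟨h0, hlip, fun s hs hB => ?_⟩, t, ⟨ht.le, le_rfl⟩, rfl⟩
  rcases hs.1.eq_or_lt with rfl | hs0
  · rw [h0, hcomp.B_zero] at hB
    exact hq hB
  · exact (hcomp.dist_lt_of_mem hs0 hB).not_ge (hγ s hs)

/-- The faster set contains the spirals issuing from `q`. -/
lemma IsGrowthCompetition.polarCurve_mem_A {Φ : Euc n ≃ M} (hsym : IsSphericallySymmetric p G Φ)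
    {q : M} (hq : q ≠ p) {lam : ℝ} (hlam : 1 < lam) {A B : ℝ → Set M}
    (hcomp : IsGrowthCompetition p q lam A B) {e₁ e₂ : Euc n} (h₁ : ‖e₁‖ = 1) (h₂ : ‖e₂‖ = 1)
    (h₁₂ : ⟪e₁, e₂⟫ = 0) {F f : ℝ → ℝ} {r₀ : ℝ} (hr₀ : 0 < r₀) (hqe : Φ (r₀ • e₁) = q)
    (hf : Continuous f) (hF : ∀ s, HasDerivAt F (f s) s) (hF0 : F r₀ = 0)
    (hGf : ∀ s, r₀ ≤ s → G s * f s = Real.sqrt (lam ^ 2 - 1)) {s : ℝ} (hs : r₀ ≤ s) :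
    Φ (polarCurve e₁ e₂ F s) ∈ A s := by
  have hlam0 : 0 ≤ lam := by linarith
  have hmono : ∀ a b, r₀ ≤ a → a ≤ b →
      dist (Φ (polarCurve e₁ e₂ F a)) (Φ (polarCurve e₁ e₂ F b)) ≤ lam * (b - a) := by
    intro a b ha hab
    refine hsym.dist_le_of_warpNorm_le (contDiff_polarCurve hF hf) hab hlam0 fun t ht => ?_
    have hrt := ha.trans ht.1
    rw [warpNorm_polarCurve h₁ h₂ h₁₂ (hr₀.trans_le hrt) (hF t), hGf t hrt,
      Real.sq_sqrt (by nlinarith), add_sub_cancel, Real.sqrt_sq hlam0]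
  have hdist : ∀ a b, r₀ ≤ a → r₀ ≤ b →
      dist (Φ (polarCurve e₁ e₂ F a)) (Φ (polarCurve e₁ e₂ F b)) ≤ lam * dist a b := by
    intro a b ha hb
    rcases le_total a b with hab | hab
    · rw [dist_comm a b, Real.dist_eq, abs_of_nonneg (sub_nonneg.2 hab)]
      exact hmono a b ha hab
    · rw [dist_comm (Φ _), Real.dist_eq, abs_of_nonneg (sub_nonneg.2 hab)]
      exact hmono b a hb hab
  have hmem := hcomp.mem_A_of_le_dist hq (γ := fun t => Φ (polarCurve e₁ e₂ F (max t r₀)))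
    (hr₀.trans_le hs) (by simp [max_eq_right hr₀.le, polarCurve, hF0, hqe])
    (LipschitzOnWith.of_dist_le_mul fun a _ b _ => by
      rw [Real.coe_toNNReal _ hlam0]
      refine (hdist _ _ (le_max_right _ _) (le_max_right _ _)).trans
        (mul_le_mul_of_nonneg_left ?_ hlam0)
      exact abs_max_sub_max_le_abs a b r₀)
    (fun t _ => by
      rw [hsym.2.2.1, norm_polarCurve h₁ h₂ h₁₂ (hr₀.le.trans (le_max_right _ _))]
      exact le_max_left _ _)
  simpa only [max_eq_left hs] using hmem

/-- Theorem 1.1(1).  On a two-dimensional, complete,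
non-compact Riemannian manifold which is rotationally symmetric about `p`
and parabolic (conformally equivalent to the Euclidean plane; by Milnor's
theorem, equivalently `∫₁^∞ dr/G(r) = ∞`), for every `q ≠ p` and every
`λ > 1` the set `B_∞` of the growth competition between `p` and `q` is
bounded. -/
theorem slower_set_bounded_of_parabolic
    {M : Type*} [MetricSpace M] [ProperSpace M] [NoncompactSpace M]
    (p : M) (G : ℝ → ℝ) (Φ : Euc 2 ≃ M)
    (hsym : IsSphericallySymmetric p G Φ)
    (hpar : ParabolicWarping G)
    (q : M) (hq : q ≠ p) (lam : ℝ) (hlam : 1 < lam)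
    (A B : ℝ → Set M) (hcomp : IsGrowthCompetition p q lam A B) :
    Bornology.IsBounded (Binfty B) := by
  set r₀ := ‖Φ.symm q‖ with hr
  have hr₀ : 0 < r₀ := by
    refine norm_pos_iff.2 fun h => hq ?_
    rw [← hsym.2.1, ← h, Φ.apply_symm_apply]
  set e := r₀⁻¹ • Φ.symm q with he_def
  have he : ‖e‖ = 1 := by
    rw [he_def, norm_smul, norm_inv, norm_norm, inv_mul_cancel₀ hr₀.ne']
  have hqe : Φ (r₀ • e) = q := by rw [he_def, smul_inv_smul₀ hr₀.ne', Φ.apply_symm_apply]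
  obtain ⟨F, f, hf, hF, hmono, hF0, hGf, R, hR⟩ :=
    exists_spiral_angle hsym.1 hpar (c := Real.sqrt (lam ^ 2 - 1))
      (Real.sqrt_pos.2 (by nlinarith)) hr₀
  have hJ := norm_quarterTurn e ▸ he
  have hmem : ∀ s, r₀ ≤ s → ∀ x, (x = polarCurve e (quarterTurn e) F s ∨
      x = polarCurve e (-quarterTurn e) F s) → Φ x ∈ A s := by
    rintro s hs x (rfl | rfl)
    · exact hcomp.polarCurve_mem_A hsym hq hlam he hJ (inner_quarterTurn_self e) hr₀ hqe hf hF
        hF0 hGf hs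
    · exact hcomp.polarCurve_mem_A hsym hq hlam he (by rwa [norm_neg])
        (by rw [inner_neg_right, inner_quarterTurn_self, neg_zero]) hr₀ hqe hf hF hF0 hGf hs
  refine (isBounded_closedBall (x := p) (r := max R 0)).subset fun y hy => ?_
  obtain ⟨t, ht, hy⟩ := mem_iUnion₂.1 hy
  rw [mem_closedBall]
  rcases (show (0 : ℝ) ≤ t from ht).eq_or_lt with rfl | ht0
  · rw [hcomp.B_zero] at hy
    rw [hy, dist_self]
    exact le_max_right _ _
  by_contra! hfar
  rw [hcomp.B_eq t ht0] at hy
  obtain ⟨η, ⟨h0, hlip, havoid⟩, u, hu, rfl⟩ := hy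
  have hsub : Icc 0 u ⊆ Icc 0 t := Icc_subset_Icc_right hu.2.le
  have hnorm : ∀ z, ‖Φ.symm z‖ = dist z p := fun z => by
    rw [← hsym.2.2.1, Φ.apply_symm_apply]
  obtain ⟨v, hv, hvr, hspiral⟩ := exists_mem_spiral he
    (continuous_iff_continuousAt.2 fun s => (hF s).continuousAt) hmono hr₀ hF0 hR
    (x := fun s => Φ.symm (η s)) hu.1
    (hsym.continuous_symm.comp_continuousOn (hlip.continuousOn.mono hsub))
    (by rw [h0, ← hsym.2.1, Φ.symm_apply_apply])
    (by rw [hnorm]; exact (le_max_left _ _).trans hfar.le)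
  have hA := hmem _ hvr _ hspiral
  rw [Φ.apply_symm_apply] at hA
  refine havoid v (hsub hv) (hcomp.monoA (norm_nonneg _) ?_ hA)
  have := hlip.dist_le_mul v (hsub hv) 0 ⟨le_rfl, ht⟩
  rwa [h0, Real.dist_0_eq_abs, abs_of_nonneg hv.1, NNReal.coe_one, one_mul, ← hnorm] at this

end GrowthComp
end
end

section
/- Let M be a two-dimensional, complete, non-compact Riemannian manifold which is rotationally symmetric about a point p ∈ M, and suppose M is hyperbolic (conformally equivalent to the hyperbolic plane) and nonpositively curved. Then for every λ > 1 there exists L > 0 such that for every q ∈ M with d(p,q) > L, the set B_∞ of the growth competition between p and q is an unbounded subset of M. -/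
/-!
Formalization framework for "growth competitions" (after the paper's
Section 2), at the metric-space level.

Since Mathlib does not yet have Riemannian metrics, a complete Riemannian
manifold is represented by a proper (hence complete; Hopf-Rinow) metric
space whose distance is the induced length (intrinsic) metric, and
spherical symmetry about `p` with warping function `G` is expressed through
global geodesic polar normal coordinates `Φ : ℝⁿ ≃ M` with `Φ 0 = p` and
`dist (Φ x) p = ‖x‖`, in which the Riemannian distance is the infimum of
lengths of Lipschitz curves measured in the warped metric
`g = dr² + G(r)² dθ²`.
-/

open Set Metric Filter MeasureTheory InnerProductGeometry NNReal ENNReal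
open scoped RealInnerProductSpace Classical

noncomputable section

namespace GrowthComp

variable {M : Type*} [MetricSpace M]

section DirectionCosine

variable {n : ℕ}

/-- The cosine of the angle between `x` and the unit vector `v` (and `0` at `x = 0`). -/
def dirCos (v x : Euc n) : ℝ := ⟪x, v⟫ / ‖x‖

lemma abs_dirCos_le_one {v : Euc n} (hv : ‖v‖ = 1) (x : Euc n) : |dirCos v x| ≤ 1 := by
  have h := abs_real_inner_le_norm x v
  rw [hv, mul_one] at h
  rw [dirCos, abs_div, abs_norm]
  exact div_le_one_of_le₀ h (norm_nonneg x)

lemma dirCos_smul (v x : Euc n) {r : ℝ} (hr : 0 < r) : dirCos v (r • x) = dirCos v x := by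
  rw [dirCos, dirCos, real_inner_smul_left, norm_smul, Real.norm_of_nonneg hr.le,
    mul_div_mul_left _ _ hr.ne']

lemma abs_dirCos_sub_le {v : Euc n} (hv : ‖v‖ = 1) {R : ℝ} (hR : 0 < R) {x y : Euc n}
    (hx : R ≤ ‖x‖) (hy : R ≤ ‖y‖) :
    |dirCos v x - dirCos v y| ≤ 2 / R * ‖x - y‖ := by
  have hx0 : 0 < ‖x‖ := hR.trans_le hx
  have hy0 : 0 < ‖y‖ := hR.trans_le hy
  have key : dirCos v x - dirCos v y =
      (⟪x - y, v⟫ + dirCos v y * (‖y‖ - ‖x‖)) / ‖x‖ := by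
    simp only [dirCos, inner_sub_left]
    field_simp
    ring
  have h1 : |⟪x - y, v⟫| ≤ ‖x - y‖ := by
    simpa [hv] using abs_real_inner_le_norm (x - y) v
  have h2 : |dirCos v y * (‖y‖ - ‖x‖)| ≤ ‖x - y‖ := by
    rw [abs_mul]
    calc _ ≤ 1 * ‖y - x‖ :=
          mul_le_mul (abs_dirCos_le_one hv y) (abs_norm_sub_norm_le y x) (abs_nonneg _) zero_le_one
      _ = _ := by rw [one_mul, norm_sub_rev]
  rw [key, abs_div, abs_norm, div_mul_eq_mul_div]
  apply div_le_div₀ (by positivity) _ hR hx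
  exact (abs_add_le _ _).trans (by linarith)

lemma hasDerivAt_dirCos {v : Euc n} {c : ℝ → Euc n} {w : Euc n} {t : ℝ}
    (hc : HasDerivAt c w t) (h0 : c t ≠ 0) :
    HasDerivAt (fun s => dirCos v (c s))
      (⟪w - ⟪w, ‖c t‖⁻¹ • c t⟫ • (‖c t‖⁻¹ • c t), v⟫ / ‖c t‖) t := by
  have hn : 0 < ‖c t‖ := norm_pos_iff.2 h0
  have h1 : HasDerivAt (fun s => ⟪c s, v⟫) ⟪w, v⟫ t := by
    simpa using hc.inner ℝ (hasDerivAt_const t v)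
  have h2 : HasDerivAt (fun s => ‖c s‖) (⟪c t, w⟫ / ‖c t‖) t := by
    have h := hc.norm_sq.sqrt (by positivity)
    simp only [Real.sqrt_sq (norm_nonneg _)] at h
    convert h using 1
    field_simp
  refine (h1.div h2 hn.ne').congr_deriv ?_
  rw [inner_sub_left, real_inner_smul_left, real_inner_smul_left, real_inner_smul_right,
    real_inner_comm (c t) w]
  field_simp

lemma mul_abs_deriv_dirCos_le {G : ℝ → ℝ} (hpos : ∀ r, 0 < r → 0 < G r)
    (hmono : MonotoneOn G (Ioi 0)) {v : Euc n} (hv : ‖v‖ = 1) {c : ℝ → Euc n} {t R : ℝ}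
    (hc : DifferentiableAt ℝ c t) (hR : 0 < R) (hRc : R ≤ ‖c t‖) :
    G R * |deriv (fun s => dirCos v (c s)) t| ≤ warpNorm G (c t) (deriv c t) := by
  have hn : 0 < ‖c t‖ := hR.trans_le hRc
  have h0 : c t ≠ 0 := norm_pos_iff.1 hn
  have hG := hpos R hR
  have hGn := hpos _ hn
  rw [(hasDerivAt_dirCos hc.hasDerivAt h0).deriv, warpNorm, if_neg h0]
  set w := deriv c t
  set e := ‖c t‖⁻¹ • c t with he
  have hen : ‖e‖ = 1 := by rw [he, norm_smul, norm_inv, norm_norm, inv_mul_cancel₀ hn.ne']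
  have hperp : ‖w - ⟪w, e⟫ • e‖ ^ 2 = ‖w‖ ^ 2 - ⟪w, e⟫ ^ 2 := by
    rw [norm_sub_sq_real, real_inner_smul_right, norm_smul, hen, Real.norm_eq_abs, mul_one,
      sq_abs]
    ring
  have h1 : |⟪w - ⟪w, e⟫ • e, v⟫| ≤ ‖w - ⟪w, e⟫ • e‖ := by
    simpa [hv] using abs_real_inner_le_norm (w - ⟪w, e⟫ • e) v
  apply Real.le_sqrt_of_sq_le
  rw [← hperp, abs_div, abs_norm]
  have hle : G R * (|⟪w - ⟪w, e⟫ • e, v⟫| / ‖c t‖) ≤ G ‖c t‖ / ‖c t‖ * ‖w - ⟪w, e⟫ • e‖ := by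
    rw [mul_div_assoc', div_mul_eq_mul_div]
    gcongr
    exact hmono hR hn hRc
  calc _ ≤ (G ‖c t‖ / ‖c t‖ * ‖w - ⟪w, e⟫ • e‖) ^ 2 := by gcongr
    _ ≤ _ := by rw [mul_pow]; nlinarith [sq_nonneg ⟪w, e⟫]

/-- A curve staying outside the ball of radius `R` turns by at most its warped length over
`G R`. -/
lemma ofReal_mul_abs_dirCos_sub_le_warpLength {G : ℝ → ℝ} (hpos : ∀ r, 0 < r → 0 < G r)
    (hmono : MonotoneOn G (Ioi 0)) {v : Euc n} (hv : ‖v‖ = 1) {c : ℝ → Euc n} {T R : ℝ}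
    {K : ℝ≥0} (hT : 0 ≤ T) (hc : LipschitzOnWith K c (Icc 0 T)) (hR : 0 < R)
    (hRc : ∀ t ∈ Icc 0 T, R ≤ ‖c t‖) :
    ENNReal.ofReal (G R * |dirCos v (c T) - dirCos v (c 0)|) ≤ warpLength G c T := by
  have hlip : LipschitzOnWith (Real.toNNReal (2 / R) * K) (fun s => dirCos v (c s))
      (uIcc 0 T) := by
    rw [uIcc_of_le hT]
    refine LipschitzOnWith.of_dist_le_mul fun s hs t ht => ?_
    rw [NNReal.coe_mul, Real.coe_toNNReal _ (by positivity), Real.dist_eq]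
    calc _ ≤ 2 / R * ‖c s - c t‖ := abs_dirCos_sub_le hv hR (hRc s hs) (hRc t ht)
      _ ≤ 2 / R * (K * dist s t) := by
        gcongr
        rw [← dist_eq_norm]
        exact hc.dist_le_mul s hs t ht
      _ = _ := by ring
  rw [← hlip.absolutelyContinuousOnInterval.integral_deriv_eq_sub,
    intervalIntegral.integral_of_le hT, ENNReal.ofReal_mul (hpos R hR).le, ← Real.norm_eq_abs,
    ofReal_norm, warpLength]
  calc _ ≤ ENNReal.ofReal (G R) * ∫⁻ t in Ioc 0 T, ‖deriv (fun s => dirCos v (c s)) t‖ₑ := by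
        gcongr
        exact enorm_integral_le_lintegral_enorm _
    _ = ∫⁻ t in Icc 0 T, ENNReal.ofReal (G R) * ‖deriv (fun s => dirCos v (c s)) t‖ₑ := by
        rw [lintegral_const_mul' _ _ ENNReal.ofReal_ne_top, restrict_Ioc_eq_restrict_Icc]
    _ ≤ _ := by
        apply lintegral_mono_ae
        rw [← restrict_Ioo_eq_restrict_Icc]
        filter_upwards [self_mem_ae_restrict measurableSet_Ioo,
          ae_restrict_of_ae hc.ae_differentiableWithinAt_of_mem_real] with t ht hd
        have htc := Ioo_subset_Icc_self ht
        rw [← ofReal_norm, ← ENNReal.ofReal_mul (hpos R hR).le, Real.norm_eq_abs]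
        exact ENNReal.ofReal_le_ofReal (mul_abs_deriv_dirCos_le hpos hmono hv
          ((hd htc).differentiableAt (Icc_mem_nhds ht.1 ht.2)) hR (hRc t htc))

end DirectionCosine

lemma IsWarping.monotoneOn {G : ℝ → ℝ} (hG : IsWarping G) (hnpc : NonposCurvWarping G) :
    MonotoneOn G (Ioi 0) := by
  refine monotoneOn_of_deriv_nonneg (convex_Ioi 0) hG.2.1.continuousOn ?_ ?_
  · rw [interior_Ioi]
    exact hG.2.1.differentiableOn (by simp)
  · rw [interior_Ioi]
    exact fun x hx => zero_le_one.trans (hnpc.2 x hx)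

section PolarChart

variable {n : ℕ} {p : M} {G : ℝ → ℝ} {Φ : Euc n ≃ M}

lemma IsSphericallySymmetric.dist_le_warpLength (h : IsSphericallySymmetric p G Φ)
    {c : ℝ → Euc n} {T : ℝ} (hT : 0 ≤ T) {K : ℝ≥0} (hc : LipschitzOnWith K c (Icc 0 T)) :
    ENNReal.ofReal (dist (Φ (c 0)) (Φ (c T))) ≤ warpLength G c T := by
  rw [h.2.2.2]
  exact sInf_le ⟨T, c, hT, rfl, rfl, ⟨K, hc⟩, rfl⟩

lemma IsSphericallySymmetric.norm_symm_sub_le (h : IsSphericallySymmetric p G Φ) (x y : M) :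
    ‖Φ.symm x‖ - ‖Φ.symm y‖ ≤ dist x y := by
  rw [← h.2.2.1, ← h.2.2.1, Φ.apply_symm_apply, Φ.apply_symm_apply]
  linarith [dist_triangle x y p]

/-- Nearby points outside a large ball around `p` have nearby directions. -/
lemma IsSphericallySymmetric.mul_abs_dirCos_sub_le (h : IsSphericallySymmetric p G Φ)
    (hmono : MonotoneOn G (Ioi 0)) {v : Euc n} (hv : ‖v‖ = 1) {R : ℝ} (hR : 0 < R) {x y : M}
    (hxy : dist x y < ‖Φ.symm x‖ - R) :
    G R * |dirCos v (Φ.symm y) - dirCos v (Φ.symm x)| ≤ dist x y := by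
  refine le_of_forall_gt_imp_ge_of_dense fun l hl => ?_
  wlog hl' : l < ‖Φ.symm x‖ - R generalizing l
  · obtain ⟨m, hm, hm'⟩ := exists_between hxy
    exact (this m hm hm').trans (hm'.le.trans (not_lt.1 hl'))
  have hl0 : 0 < l := dist_nonneg.trans_lt hl
  have hlt := (ENNReal.ofReal_lt_ofReal_iff hl0).2 hl
  have heq := h.2.2.2 (Φ.symm x) (Φ.symm y)
  rw [Φ.apply_symm_apply, Φ.apply_symm_apply] at heq
  rw [heq, sInf_lt_iff] at hlt
  obtain ⟨_, ⟨T, c, hT, hc0, hcT, ⟨K, hK⟩, rfl⟩, hlen⟩ := hlt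
  have hRc : ∀ t ∈ Icc 0 T, R ≤ ‖c t‖ := by
    intro t ht
    have h1 := h.dist_le_warpLength ht.1 (hK.mono (Icc_subset_Icc_right ht.2))
    have h2 : warpLength G c t ≤ warpLength G c T :=
      lintegral_mono_set (Icc_subset_Icc_right ht.2)
    have h3 := (ENNReal.ofReal_lt_ofReal_iff hl0).1 ((h1.trans h2).trans_lt hlen)
    have h4 := h.norm_symm_sub_le (Φ (c 0)) (Φ (c t))
    rw [Φ.symm_apply_apply, Φ.symm_apply_apply, hc0] at h4
    rw [hc0] at h3
    linarith
  have h5 := ofReal_mul_abs_dirCos_sub_le_warpLength h.1.1 hmono hv hT hK hR hRc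
  rw [hc0, hcT] at h5
  exact ((ENNReal.ofReal_lt_ofReal_iff hl0).1 (h5.trans_lt hlen)).le

lemma warpNorm_smul_self {u : Euc n} (hu : ‖u‖ = 1) {r : ℝ} (hr : 0 ≤ r) :
    warpNorm G (r • u) u = 1 := by
  rw [warpNorm]
  split_ifs with h0
  · exact hu
  · have hr0 : r ≠ 0 := fun h => h0 (by rw [h, zero_smul])
    rw [norm_smul, hu, Real.norm_of_nonneg hr, mul_one, smul_smul, inv_mul_cancel₀ hr0, one_smul,
      real_inner_self_eq_norm_sq, hu]
    simp

lemma IsSphericallySymmetric.lipschitzOnWith_ray (h : IsSphericallySymmetric p G Φ)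
    {u : Euc n} (hu : ‖u‖ = 1) : LipschitzOnWith 1 (fun s : ℝ => Φ (s • u)) (Ici 0) := by
  refine LipschitzOnWith.of_dist_le_mul fun s hs t ht => ?_
  rw [NNReal.coe_one, one_mul]
  wlog hst : s ≤ t generalizing s t
  · rw [dist_comm, dist_comm s]
    exact this t ht s hs (le_of_not_ge hst)
  have hd : ∀ τ, HasDerivAt (fun τ : ℝ => (s + τ) • u) u τ := fun τ => by
    simpa using ((hasDerivAt_id τ).const_add s).smul_const u
  have hlip : LipschitzOnWith 1 (fun τ : ℝ => (s + τ) • u) (Icc 0 (t - s)) :=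
    LipschitzOnWith.of_dist_le_mul fun a _ b _ => by
      rw [dist_eq_norm, ← sub_smul, norm_smul, hu]
      simp [Real.dist_eq]
  have hle := h.dist_le_warpLength (sub_nonneg.2 hst) hlip
  have hlen : warpLength G (fun τ : ℝ => (s + τ) • u) (t - s) = ENNReal.ofReal (t - s) := by
    rw [warpLength, setLIntegral_congr_fun (g := fun _ => 1) measurableSet_Icc]
    · simp
    · intro τ hτ
      simp only [(hd τ).deriv, warpNorm_smul_self hu (add_nonneg hs hτ.1), ENNReal.ofReal_one]
  rw [hlen, ENNReal.ofReal_le_ofReal_iff (sub_nonneg.2 hst)] at hle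
  simpa [dist_comm s, Real.dist_eq, abs_of_nonneg (sub_nonneg.2 hst)] using hle

end PolarChart

/-- A primitive of `1 / G` has small increment on a neighbourhood of infinity. -/
lemma HyperbolicWarping.exists_small_primitive {G : ℝ → ℝ} (hhyp : HyperbolicWarping G)
    (hpos : ∀ r, 0 < r → 0 < G r) (hmono : MonotoneOn G (Ioi 0)) {ε : ℝ} (hε : 0 < ε) :
    ∃ (ρ : ℝ) (F : ℝ → ℝ), 1 ≤ ρ ∧ F ρ = 0 ∧ (∀ r, ρ ≤ r → F r < ε) ∧
      ∀ a b, ρ ≤ a → a ≤ b → (b - a) / G b ≤ F b - F a := by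
  have hanti : AntitoneOn (fun r => (G r)⁻¹) (Ioi 0) := fun a ha b hb hab =>
    inv_anti₀ (hpos a ha) (hmono ha hb hab)
  have hsub : Ici (1 : ℝ) ⊆ Ioi 0 := fun x hx => mem_Ioi.2 (zero_lt_one.trans_le hx)
  have hint : ∀ a b, 1 ≤ a → 1 ≤ b → IntervalIntegrable (fun r => (G r)⁻¹) volume a b :=
    fun a b ha hb => AntitoneOn.intervalIntegrable <| hanti.mono fun x hx =>
      hsub ((le_min ha hb).trans hx.1)
  have hIci : IntegrableOn (fun r => (G r)⁻¹) (Ici 1) := by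
    refine ⟨(aemeasurable_restrict_of_antitoneOn measurableSet_Ici
      (hanti.mono hsub)).aestronglyMeasurable, ?_⟩
    rw [hasFiniteIntegral_iff_ofReal]
    · exact hhyp
    · filter_upwards [self_mem_ae_restrict measurableSet_Ici] with x hx
      exact (inv_pos.2 (hpos x (hsub hx))).le
  have hstep : ∀ a b, 1 ≤ a → a ≤ b →
      (b - a) / G b ≤ (∫ r in (1 : ℝ)..b, (G r)⁻¹) - ∫ r in (1 : ℝ)..a, (G r)⁻¹ := by
    intro a b ha hab
    have hb := ha.trans hab
    rw [intervalIntegral.integral_interval_sub_left (hint 1 b le_rfl hb) (hint 1 a le_rfl ha)]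
    calc _ = ∫ _ in a..b, (G b)⁻¹ := by
          rw [intervalIntegral.integral_const, smul_eq_mul, div_eq_mul_inv]
      _ ≤ _ := intervalIntegral.integral_mono_on hab (by simp) (hint a b ha hb)
          fun x hx => hanti (hsub (ha.trans hx.1)) (hsub hb) hx.2
  have hlim := intervalIntegral_tendsto_integral_Ioi 1 (hIci.mono_set Ioi_subset_Ici_self)
    tendsto_id
  set I := ∫ r in Ioi (1 : ℝ), (G r)⁻¹
  have hmonoF : ∀ a b, 1 ≤ a → a ≤ b →
      (∫ r in (1 : ℝ)..a, (G r)⁻¹) ≤ ∫ r in (1 : ℝ)..b, (G r)⁻¹ := fun a b ha hab => by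
    have h1 := hstep a b ha hab
    have h2 : 0 ≤ (b - a) / G b :=
      div_nonneg (sub_nonneg.2 hab) (hpos b (hsub (ha.trans hab))).le
    linarith
  obtain ⟨ρ, hρI, hρ⟩ :=
    ((hlim.eventually (lt_mem_nhds (sub_lt_self I hε))).and (eventually_ge_atTop 1)).exists
  refine ⟨ρ, fun r => (∫ x in (1 : ℝ)..r, (G x)⁻¹) - ∫ x in (1 : ℝ)..ρ, (G x)⁻¹, hρ, sub_self _,
    fun r hr => ?_, fun a b ha hab => ?_⟩
  · have hle : (∫ x in (1 : ℝ)..r, (G x)⁻¹) ≤ I := ge_of_tendsto hlim <| by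
      filter_upwards [eventually_ge_atTop r] with b hb using hmonoF r b (hρ.trans hr) hb
    simp only [id] at hρI
    linarith
  · simpa using hstep a b (hρ.trans ha) hab

section Competition

variable {n : ℕ} {p q : M} {G : ℝ → ℝ} {Φ : Euc n ≃ M} {lam : ℝ}

/-- A `lam`-Lipschitz path which is far from `p` whenever it has turned by more than
`2 * lam * F (t / 2 + ρ)` never turns by more than that. -/
lemma IsSphericallySymmetric.one_sub_le_dirCos_path (h : IsSphericallySymmetric p G Φ)
    (hmono : MonotoneOn G (Ioi 0)) {v : Euc n} (hv : ‖v‖ = 1) (hlam : 0 < lam)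
    {ρ : ℝ} (hρ : 0 < ρ) {F : ℝ → ℝ} (hFρ : F ρ = 0)
    (hF : ∀ a b, ρ ≤ a → a ≤ b → (b - a) / G b ≤ F b - F a)
    {γ : ℝ → M} {T : ℝ} (hγ : LipschitzOnWith (Real.toNNReal lam) γ (Icc 0 T))
    (hγ0 : dirCos v (Φ.symm (γ 0)) = 1)
    (hfar : ∀ t ∈ Icc 0 T, dirCos v (Φ.symm (γ t)) < 1 - 2 * lam * F (t / 2 + ρ) →
      t / 2 + ρ + 1 ≤ ‖Φ.symm (γ t)‖) :
    ∀ t ∈ Icc 0 T, 1 - 2 * lam * F (t / 2 + ρ) ≤ dirCos v (Φ.symm (γ t)) := by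
  have hstart : 1 - 2 * lam * F (0 / 2 + ρ) ≤ dirCos v (Φ.symm (γ 0)) := by
    rw [zero_div, zero_add, hFρ, hγ0]
    simp
  have hgrid : ∀ k : ℕ, ∀ t ∈ Icc 0 T, t ≤ k * (1 / (2 * lam)) →
      1 - 2 * lam * F (t / 2 + ρ) ≤ dirCos v (Φ.symm (γ t)) := by
    intro k
    induction k with
    | zero =>
      intro t ht htk
      obtain rfl : t = 0 := le_antisymm (by simpa using htk) ht.1
      exact hstart
    | succ k ih =>
      intro t ht htk
      by_contra! hlt
      set s := max 0 (t - 1 / (2 * lam)) with hs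
      have hs0 : 0 ≤ s := le_max_left _ _
      have hst : s ≤ t := max_le ht.1 (sub_le_self _ (by positivity))
      have hsT : s ∈ Icc 0 T := ⟨hs0, hst.trans ht.2⟩
      have hprev : 1 - 2 * lam * F (s / 2 + ρ) ≤ dirCos v (Φ.symm (γ s)) := by
        refine ih s hsT (max_le (by positivity) ?_)
        push_cast at htk
        linarith
      have hR : 0 < t / 2 + ρ := add_pos_of_nonneg_of_pos (div_nonneg ht.1 zero_le_two) hρ
      have hGR := h.1.1 _ hR
      have hdist : dist (γ t) (γ s) ≤ lam * (t - s) := by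
        have := hγ.dist_le_mul t ht s hsT
        rwa [Real.coe_toNNReal _ hlam.le, Real.dist_eq, abs_of_nonneg (sub_nonneg.2 hst)] at this
      have hclose : lam * (t - s) < 1 := by
        have h1 : t - s ≤ 1 / (2 * lam) := by linarith [le_max_right 0 (t - 1 / (2 * lam))]
        calc _ ≤ lam * (1 / (2 * lam)) := by gcongr
          _ = 1 / 2 := by field_simp
          _ < 1 := by norm_num
      have hturn := h.mul_abs_dirCos_sub_le hmono hv hR (x := γ t) (y := γ s)
        (by linarith [hfar t ht hlt])
      have hFst := hF (s / 2 + ρ) (t / 2 + ρ) (by linarith) (by linarith)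
      rw [div_le_iff₀ hGR] at hFst
      have habs := le_abs_self (dirCos v (Φ.symm (γ s)) - dirCos v (Φ.symm (γ t)))
      have hmul : G (t / 2 + ρ) * (dirCos v (Φ.symm (γ s)) - dirCos v (Φ.symm (γ t))) ≤
          G (t / 2 + ρ) * (2 * lam * (F (t / 2 + ρ) - F (s / 2 + ρ))) := by
        calc _ ≤ lam * (t - s) := (mul_le_mul_of_nonneg_left habs hGR.le).trans
              (hturn.trans hdist)
          _ = 2 * lam * (t / 2 + ρ - (s / 2 + ρ)) := by ring
          _ ≤ 2 * lam * ((F (t / 2 + ρ) - F (s / 2 + ρ)) * G (t / 2 + ρ)) := by gcongr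
          _ = _ := by ring
      linarith [le_of_mul_le_mul_left hmul hGR]
  intro t ht
  obtain ⟨k, hk⟩ := exists_nat_ge (t / (1 / (2 * lam)))
  exact hgrid k t ht ((div_le_iff₀ (by positivity)).1 hk)

lemma IsGrowthCompetition.ray_mem {A B : ℝ → Set M} (hAB : IsGrowthCompetition p q lam A B)
    (h : IsSphericallySymmetric p G Φ) {u : Euc n} (hu : ‖u‖ = 1) {t : ℝ} (ht : 0 < t)
    (havoid : ∀ s ∈ Icc 0 t, Φ (s • u) ∉ A s) {r : ℝ} (hr : r ∈ Ico 0 t) :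
    Φ (r • u) ∈ B t := by
  rw [hAB.B_eq t ht]
  exact ⟨fun s => Φ (s • u), ⟨by simp [h.2.1],
    (h.lipschitzOnWith_ray hu).mono Icc_subset_Ici_self, havoid⟩, r, hr, rfl⟩

/-- If `q` is far from `p`, a ray from `p` avoids `A` up to time `t` as soon as its angle with
the ray through `q` is not too small. -/
lemma IsGrowthCompetition.ray_avoids {A B : ℝ → Set M}
    (hAB : IsGrowthCompetition p q lam A B) (h : IsSphericallySymmetric p G Φ)
    (hmono : MonotoneOn G (Ioi 0)) (hlam : 1 < lam) {ρ : ℝ} (hρ : 0 < ρ)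
    (hq : 2 * (lam + 1) * (ρ + 2) < dist p q) {F : ℝ → ℝ} (hFρ : F ρ = 0)
    (hF : ∀ a b, ρ ≤ a → a ≤ b → (b - a) / G b ≤ F b - F a)
    {t : ℝ} (ht : 0 ≤ t) {u : Euc n} (hu : ‖u‖ = 1)
    (hdir : dirCos (‖Φ.symm q‖⁻¹ • Φ.symm q) u < 1 - 2 * lam * F (t / 2 + ρ)) :
    Φ (t • u) ∉ A t := by
  have hlam0 : 0 < lam := zero_lt_one.trans hlam
  have hqn : ‖Φ.symm q‖ = dist p q := by
    rw [← h.2.2.1, Φ.apply_symm_apply, dist_comm]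
  have hqpos : 0 < ‖Φ.symm q‖ := by
    rw [hqn]
    exact lt_trans (by positivity) hq
  set v := ‖Φ.symm q‖⁻¹ • Φ.symm q with hvdef
  have hv : ‖v‖ = 1 := by rw [hvdef, norm_smul, norm_inv, norm_norm, inv_mul_cancel₀ hqpos.ne']
  have hvq : dirCos v (Φ.symm q) = 1 := by
    rw [dirCos, hvdef, real_inner_smul_right, real_inner_self_eq_norm_sq]
    field_simp
  have hFmono : ∀ a b, 0 ≤ a → a ≤ b → F (a / 2 + ρ) ≤ F (b / 2 + ρ) := fun a b ha hab => by
    have h1 := hF (a / 2 + ρ) (b / 2 + ρ) (by linarith) (by linarith)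
    have h2 : 0 ≤ (b / 2 + ρ - (a / 2 + ρ)) / G (b / 2 + ρ) :=
      div_nonneg (by linarith) (h.1.1 _ (by linarith)).le
    linarith
  have hgrid : ∀ k : ℕ, ∀ t, 0 ≤ t → t ≤ k * (1 / (2 * lam)) → ∀ u : Euc n, ‖u‖ = 1 →
      dirCos v u < 1 - 2 * lam * F (t / 2 + ρ) → Φ (t • u) ∉ A t := by
    intro k
    induction k with
    | zero =>
      intro t ht htk u hu hdir hmem
      obtain rfl : t = 0 := le_antisymm (by simpa using htk) ht
      rw [hAB.A_zero, zero_smul, h.2.1, mem_singleton_iff] at hmem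
      rw [hmem, dist_self] at hq
      exact hq.not_gt (by positivity)
    | succ k ih =>
      intro t ht htk u hu hdir hmem
      by_cases htk' : t ≤ k * (1 / (2 * lam))
      · exact ih t ht htk' u hu hdir hmem
      have htpos : 0 < t := lt_of_le_of_lt (by positivity) (not_le.1 htk')
      rw [hAB.A_eq t htpos] at hmem
      obtain ⟨γ, ⟨hγ0, hγ, hγB⟩, T, hT, hγT⟩ := hmem
      have hnorm : ‖Φ.symm (γ T)‖ = t := by
        rw [hγT, Φ.symm_apply_apply, norm_smul, hu, Real.norm_of_nonneg ht, mul_one]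
      have hlip : ∀ a ∈ Icc 0 t, ∀ b ∈ Icc 0 t, a ≤ b →
          ‖Φ.symm (γ b)‖ - ‖Φ.symm (γ a)‖ ≤ lam * (b - a) ∧
          ‖Φ.symm (γ a)‖ - ‖Φ.symm (γ b)‖ ≤ lam * (b - a) := by
        intro a ha b hb hab
        have hd := hγ.dist_le_mul b hb a ha
        rw [Real.coe_toNNReal _ hlam0.le, Real.dist_eq, abs_of_nonneg (sub_nonneg.2 hab)] at hd
        exact ⟨(h.norm_symm_sub_le _ _).trans hd,
          (h.norm_symm_sub_le _ _).trans (by rwa [dist_comm])⟩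
      have hahead : ∀ s ∈ Icc 0 T, dirCos v (Φ.symm (γ s)) < 1 - 2 * lam * F (s / 2 + ρ) →
          s - 1 ≤ ‖Φ.symm (γ s)‖ := by
        intro s hs hdirs
        have hst : s ∈ Icc 0 t := ⟨hs.1, hs.2.trans hT.2⟩
        by_cases hsk : s ≤ k * (1 / (2 * lam))
        · by_contra! hlt
          have hs1 : 0 < s := by linarith [norm_nonneg (Φ.symm (γ s))]
          apply hγB s hst
          by_cases h0 : Φ.symm (γ s) = 0
          · rw [Φ.symm_apply_eq, h.2.1] at h0
            rw [h0]
            exact hAB.monoB le_rfl hs.1 (by rw [hAB.B_zero]; exact mem_singleton p)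
          have hn : 0 < ‖Φ.symm (γ s)‖ := norm_pos_iff.2 h0
          have hw : ‖‖Φ.symm (γ s)‖⁻¹ • Φ.symm (γ s)‖ = 1 := by
            rw [norm_smul, norm_inv, norm_norm, inv_mul_cancel₀ hn.ne']
          have hmemB := hAB.ray_mem h hw hs1 (r := ‖Φ.symm (γ s)‖)
            (fun σ hσ => ih σ hσ.1 (hσ.2.trans hsk) _ hw <| by
              rw [dirCos_smul v _ (inv_pos.2 hn)]
              have := mul_le_mul_of_nonneg_left (hFmono σ s hσ.1 hσ.2)
                (mul_pos two_pos hlam0).le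
              linarith) ⟨hn.le, by linarith⟩
          rwa [smul_smul, mul_inv_cancel₀ hn.ne', one_smul, Φ.apply_symm_apply] at hmemB
        · have h1 := (hlip s hst T hT hs.2).1
          rw [hnorm] at h1
          have h2 : lam * (T - s) ≤ lam * (1 / (2 * lam)) := by
            gcongr
            push_cast at htk
            linarith [not_le.1 hsk, hT.2]
          have h3 : lam * (1 / (2 * lam)) = 1 / 2 := by field_simp
          linarith [hst.2]
      have hfar : ∀ s ∈ Icc 0 T, dirCos v (Φ.symm (γ s)) < 1 - 2 * lam * F (s / 2 + ρ) →
          s / 2 + ρ + 1 ≤ ‖Φ.symm (γ s)‖ := by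
        intro s hs hdirs
        have h1 := hahead s hs hdirs
        have h2 := (hlip 0 ⟨le_rfl, ht⟩ s ⟨hs.1, hs.2.trans hT.2⟩ hs.1).2
        rw [hγ0, hqn] at h2
        nlinarith
      have hend := h.one_sub_le_dirCos_path hmono hv hlam0 hρ hFρ hF
        (hγ.mono (Icc_subset_Icc_right hT.2)) (by rw [hγ0, hvq]) hfar T ⟨hT.1, le_rfl⟩
      rw [hγT, Φ.symm_apply_apply, dirCos_smul v u htpos] at hend
      have := mul_le_mul_of_nonneg_left (hFmono T t hT.1 hT.2) (mul_pos two_pos hlam0).le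
      linarith
  obtain ⟨k, hk⟩ := exists_nat_ge (t / (1 / (2 * lam)))
  exact hgrid k t ht ((div_le_iff₀ (by positivity)).1 hk) u hu hdir

end Competition

/-- Theorem 1.1(2).  On a two-dimensional, complete,
non-compact Riemannian manifold which is rotationally symmetric about `p`,
nonpositively curved, and hyperbolic (conformally equivalent to the
hyperbolic plane; by Milnor's theorem, equivalently `∫₁^∞ dr/G(r) < ∞`),
for every `λ > 1` there is `L > 0` such that whenever `d(p,q) > L`, the set
`B_∞` of the growth competition between `p` and `q` is unbounded. -/
theorem slower_set_unbounded_of_hyperbolic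
    {M : Type*} [MetricSpace M] [ProperSpace M] [NoncompactSpace M]
    (p : M) (G : ℝ → ℝ) (Φ : Euc 2 ≃ M)
    (hsym : IsSphericallySymmetric p G Φ)
    (hhyp : HyperbolicWarping G) (hnpc : NonposCurvWarping G)
    (lam : ℝ) (hlam : 1 < lam) :
    ∃ L : ℝ, 0 < L ∧ ∀ q : M, L < dist p q →
      ∀ A B : ℝ → Set M, IsGrowthCompetition p q lam A B →
        ¬ Bornology.IsBounded (Binfty B) := by
  have hmono := hsym.1.monotoneOn hnpc
  have hlam0 : 0 < lam := zero_lt_one.trans hlam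
  obtain ⟨ρ, F, hρ, hFρ, hFlt, hF⟩ :=
    hhyp.exists_small_primitive hsym.1.1 hmono (inv_pos.2 hlam0)
  refine ⟨2 * (lam + 1) * (ρ + 2), by positivity, fun q hq A B hAB hbdd => ?_⟩
  have hqpos : 0 < ‖Φ.symm q‖ := by
    rw [← hsym.2.2.1, Φ.apply_symm_apply, dist_comm]
    exact lt_trans (by positivity) hq
  have hv : ‖‖Φ.symm q‖⁻¹ • Φ.symm q‖ = 1 := by
    rw [norm_smul, norm_inv, norm_norm, inv_mul_cancel₀ hqpos.ne']
  have hu : ‖-(‖Φ.symm q‖⁻¹ • Φ.symm q)‖ = 1 := by rw [norm_neg, hv]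
  have havoid : ∀ t, 0 ≤ t → Φ (t • -(‖Φ.symm q‖⁻¹ • Φ.symm q)) ∉ A t := fun t ht =>
    hAB.ray_avoids hsym hmono hlam (zero_lt_one.trans_le hρ) hq hFρ hF ht hu <| by
      have h1 : lam * F (t / 2 + ρ) < 1 := by
        calc _ < lam * lam⁻¹ := by gcongr; exact hFlt _ (by linarith)
          _ = 1 := mul_inv_cancel₀ hlam0.ne'
      rw [dirCos, hu, inner_neg_left, real_inner_self_eq_norm_sq, hv]
      linarith
  obtain ⟨C, hC⟩ := hbdd.subset_closedBall p
  have hC0 : 0 ≤ |C| + 1 := by positivity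
  have hmem : Φ ((|C| + 1) • -(‖Φ.symm q‖⁻¹ • Φ.symm q)) ∈ Binfty B :=
    mem_iUnion₂.2 ⟨|C| + 2, mem_Ici.2 (by positivity), hAB.ray_mem hsym hu (by positivity)
      (fun s hs => havoid s hs.1) ⟨hC0, by linarith⟩⟩
  have hle := hC hmem
  rw [mem_closedBall, hsym.2.2.1, norm_smul, hu, Real.norm_of_nonneg hC0, mul_one] at hle
  linarith [le_abs_self C]

end GrowthComp
end
end

section
/- For every n ≥ 0, the set Ω_n is an open subset of M. -/
/-!
Formalization framework for "growth competitions" (after the paper's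
Section 2), at the metric-space level.

Since Mathlib does not yet have Riemannian metrics, a complete Riemannian
manifold is represented by a proper (hence complete; Hopf-Rinow) metric
space whose distance is the induced length (intrinsic) metric, and
spherical symmetry about `p` with warping function `G` is expressed through
global geodesic polar normal coordinates `Φ : ℝⁿ ≃ M` with `Φ 0 = p` and
`dist (Φ x) p = ‖x‖`, in which the Riemannian distance is the infimum of
lengths of Lipschitz curves measured in the warped metric
`g = dr² + G(r)² dθ²`.
-/

open Set Metric Filter MeasureTheory InnerProductGeometry NNReal ENNReal
open scoped RealInnerProductSpace Classical

noncomputable section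

namespace GrowthComp

variable {M : Type*} [MetricSpace M]

/-- A Lipschitz path avoiding `S`, parametrized on `[0, 1]`, bounds `dCompl S` by its Lipschitz
constant. -/
theorem dCompl_le_of_lipschitzOnWith {S : Set M} {x y : M} {C : ℝ≥0} {f : ℝ → M}
    (h0 : f 0 = x) (h1 : f 1 = y) (hf : LipschitzOnWith C f (Set.Icc 0 1))
    (hS : ∀ t ∈ Set.Icc (0 : ℝ) 1, f t ∉ S) : dCompl S x y ≤ C := by
  have hinf : dCompl S x y ≤ pathLength f 1 :=
    sInf_le ⟨1, f, zero_le_one, h0, h1, ⟨C, hf⟩, hS, rfl⟩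
  refine hinf.trans ?_
  have hid : eVariationOn (id : ℝ → ℝ) (Set.Icc 0 1) ≤ 1 := by
    simp
  calc eVariationOn f (Set.Icc 0 1) ≤ C * eVariationOn (id : ℝ → ℝ) (Set.Icc 0 1) :=
        hf.comp_eVariationOn_le (Set.mapsTo_id _)
    _ ≤ C * 1 := by gcongr
    _ = C := mul_one _

/-- The arc length function of a Lipschitz path is continuous. -/
theorem continuousOn_variationOnFromTo_of_lipschitzOnWith {K : ℝ≥0} {γ : ℝ → M} {s : Set ℝ}
    (hγ : LipschitzOnWith K γ s) {a : ℝ} (ha : a ∈ s) :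
    ContinuousOn (variationOnFromTo γ s a) s := by
  have hbv := hγ.locallyBoundedVariationOn
  refine (LipschitzOnWith.of_le_add_mul K fun b hb c hc => ?_).continuousOn
  rcases le_total b c with hbc | hcb
  · have := variationOnFromTo.monotoneOn hbv ha hb hc hbc
    have : 0 ≤ (K : ℝ) * dist b c := by positivity
    linarith
  · have hadd := variationOnFromTo.add hbv ha hc hb
    have hid : eVariationOn (id : ℝ → ℝ) (s ∩ Set.Icc c b) ≤ ENNReal.ofReal (b - c) :=
      ((monotoneOn_id (s := s)).eVariationOn_eq hc hb).le
    have hle : eVariationOn γ (s ∩ Set.Icc c b) ≤ ENNReal.ofReal (K * (b - c)) :=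
      calc eVariationOn γ (s ∩ Set.Icc c b)
          ≤ K * eVariationOn (id : ℝ → ℝ) (s ∩ Set.Icc c b) :=
            (hγ.mono Set.inter_subset_left).comp_eVariationOn_le (Set.mapsTo_id _)
        _ ≤ K * ENNReal.ofReal (b - c) := by gcongr
        _ = ENNReal.ofReal (K * (b - c)) := by
            rw [ENNReal.ofReal_mul K.coe_nonneg, ENNReal.ofReal_coe_nnreal]
    have hcb' : variationOnFromTo γ s c b ≤ K * (b - c) := by
      rw [variationOnFromTo.eq_of_le _ _ hcb]
      exact ENNReal.toReal_le_of_le_ofReal (mul_nonneg K.coe_nonneg (sub_nonneg.2 hcb)) hle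
    rw [Real.dist_eq, abs_of_nonneg (sub_nonneg.2 hcb)]
    linarith

/-- Along a path of locally bounded variation, distances are bounded by differences of arc
length. -/
theorem dist_le_abs_variationOnFromTo_sub {γ : ℝ → M} {s : Set ℝ}
    (hγ : LocallyBoundedVariationOn γ s) {a b c : ℝ} (ha : a ∈ s) (hb : b ∈ s) (hc : c ∈ s) :
    dist (γ b) (γ c) ≤ |variationOnFromTo γ s a b - variationOnFromTo γ s a c| := by
  wlog hbc : b ≤ c generalizing b c
  · rw [dist_comm, abs_sub_comm]
    exact this hc hb (le_of_not_ge hbc)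
  have hadd := variationOnFromTo.add hγ ha hb hc
  have hle : dist (γ b) (γ c) ≤ variationOnFromTo γ s b c := by
    rw [variationOnFromTo.eq_of_le _ _ hbc, dist_edist]
    exact ENNReal.toReal_mono (hγ b c hb hc)
      (eVariationOn.edist_le _ ⟨hb, le_rfl, hbc⟩ ⟨hc, hbc, le_rfl⟩)
  rw [abs_sub_comm]
  exact (by linarith : dist (γ b) (γ c) ≤ _).trans (le_abs_self _)

/-- If `dCompl S x y < C`, then `x` and `y` are joined by a `C`-Lipschitz path on `[0, 1]`
avoiding `S`, obtained by reparametrizing a short path proportionally to arc length. -/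
theorem exists_lipschitzOnWith_of_dCompl_lt {S : Set M} {x y : M} {C : ℝ≥0}
    (h : dCompl S x y < C) :
    ∃ f : ℝ → M, f 0 = x ∧ f 1 = y ∧ LipschitzOnWith C f (Set.Icc 0 1) ∧
      ∀ t ∈ Set.Icc (0 : ℝ) 1, f t ∉ S := by
  obtain ⟨L, ⟨T, γ, hT, h0, h1, ⟨K, hK⟩, hS, rfl⟩, hL⟩ := sInf_lt_iff.1 h
  have hbv := hK.locallyBoundedVariationOn
  have h0T : (0 : ℝ) ∈ Set.Icc 0 T := Set.left_mem_Icc.2 hT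
  have hTT : T ∈ Set.Icc 0 T := Set.right_mem_Icc.2 hT
  set v := variationOnFromTo γ (Set.Icc 0 T) 0 with hv
  have hv0 : v 0 = 0 := variationOnFromTo.self _ _ _
  have hvT0 : 0 ≤ v T := variationOnFromTo.nonneg_of_le _ _ hT
  have hvT : v T ≤ C := by
    rw [hv, variationOnFromTo.eq_of_le _ _ hT, Set.inter_self]
    exact ENNReal.toReal_le_of_le_ofReal C.coe_nonneg (by simpa [pathLength] using hL.le)
  have hdist : ∀ a ∈ Set.Icc 0 T, ∀ b ∈ Set.Icc 0 T, dist (γ a) (γ b) ≤ |v a - v b| :=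
    fun a ha b hb => dist_le_abs_variationOnFromTo_sub hbv h0T ha hb
  have hivt : ∀ s ∈ Set.Icc (0 : ℝ) 1, ∃ t ∈ Set.Icc 0 T, v t = s * v T := by
    intro s hs
    refine intermediate_value_Icc hT
      (continuousOn_variationOnFromTo_of_lipschitzOnWith hK h0T) ⟨?_, ?_⟩
    · rw [← hv, hv0]
      exact mul_nonneg hs.1 hvT0
    · exact mul_le_of_le_one_left hvT0 hs.2
  choose! τ hτ hvτ using hivt
  refine ⟨γ ∘ τ, ?_, ?_, LipschitzOnWith.of_dist_le_mul fun a ha b hb => ?_,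
    fun t ht => hS _ (hτ t ht)⟩
  · have hm : (0 : ℝ) ∈ Set.Icc (0 : ℝ) 1 := Set.left_mem_Icc.2 zero_le_one
    have := hdist _ (hτ 0 hm) 0 h0T
    rw [hvτ 0 hm, hv0, zero_mul, sub_zero, abs_zero] at this
    rw [← h0]
    exact dist_le_zero.1 this
  · have hm : (1 : ℝ) ∈ Set.Icc (0 : ℝ) 1 := Set.right_mem_Icc.2 zero_le_one
    have := hdist _ (hτ 1 hm) T hTT
    rw [hvτ 1 hm, one_mul, sub_self, abs_zero] at this
    rw [← h1]
    exact dist_le_zero.1 this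
  · calc dist (γ (τ a)) (γ (τ b)) ≤ |v (τ a) - v (τ b)| := hdist _ (hτ a ha) _ (hτ b hb)
      _ = v T * dist a b := by
        rw [hvτ a ha, hvτ b hb, ← sub_mul, abs_mul, abs_of_nonneg hvT0, Real.dist_eq, mul_comm]
      _ ≤ C * dist a b := by gcongr

/-- In a proper space, for open `S` and a continuous bound `c`, the points of the complement of `S`
whose intrinsic distance to `q` is at most `c` form a closed set. -/
theorem isClosed_setOf_dCompl_le [ProperSpace M] {S : Set M} (hS : IsOpen S) (q : M)
    {c : M → ℝ≥0} (hc : Continuous c) :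
    IsClosed {x | x ∉ S ∧ dCompl S x q ≤ c x} := by
  refine isClosed_iff_ultrafilter.2 fun x u hu hmem => ?_
  have hxS : x ∉ S := hS.isClosed_compl.mem_of_tendsto (tendsto_id'.2 hu)
    (mem_of_superset hmem fun y hy => hy.1)
  refine ⟨hxS, ENNReal.le_of_forall_pos_le_add fun ε hε _ => ?_⟩
  have hex : ∀ y ∈ {x | x ∉ S ∧ dCompl S x q ≤ c x}, ∃ f : ℝ → M, f 0 = y ∧ f 1 = q ∧
      LipschitzOnWith (c y + ε) f (Set.Icc 0 1) ∧ ∀ t ∈ Set.Icc (0 : ℝ) 1, f t ∉ S :=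
    fun y hy => exists_lipschitzOnWith_of_dCompl_lt
      (hy.2.trans_lt (ENNReal.coe_lt_coe.2 (lt_add_of_pos_right _ hε)))
  have : Nonempty M := ⟨q⟩
  choose! f hf0 hf1 hfL hfS using hex
  have hm0 : (0 : ℝ) ∈ Set.Icc (0 : ℝ) 1 := Set.left_mem_Icc.2 zero_le_one
  have hm1 : (1 : ℝ) ∈ Set.Icc (0 : ℝ) 1 := Set.right_mem_Icc.2 zero_le_one
  have hcu : Tendsto (fun y => ((c y + ε : ℝ≥0) : ℝ)) u (nhds ((c x + ε : ℝ≥0) : ℝ)) :=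
    ((NNReal.continuous_coe.comp (hc.add continuous_const)).tendsto x).mono_left hu
  have hlim : ∀ t ∈ Set.Icc (0 : ℝ) 1, ∃ z, Tendsto (fun y => f y t) u (nhds z) := by
    intro t ht
    have hbdd : ∀ᶠ y in u, f y t ∈ closedBall q ((c x + ε : ℝ≥0) + 1) := by
      filter_upwards [hmem, hcu.eventually_le_const (lt_add_one _)] with y hy hcy
      have hd := (hfL y hy).dist_le_mul t ht 1 hm1
      have ht1 : dist t 1 ≤ 1 := by
        rw [Real.dist_eq, abs_le]
        constructor <;> linarith [ht.1, ht.2]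
      rw [hf1 y hy] at hd
      exact hd.trans ((mul_le_of_le_one_right (NNReal.coe_nonneg _) ht1).trans hcy)
    obtain ⟨z, -, hz⟩ := (isCompact_closedBall q _).ultrafilter_le_nhds
      (u.map fun y => f y t) (le_principal_iff.2 hbdd)
    exact ⟨z, hz⟩
  choose! g hg using hlim
  have hL : LipschitzOnWith (c x + ε) g (Set.Icc 0 1) := by
    refine LipschitzOnWith.of_dist_le_mul fun a ha b hb => ?_
    refine le_of_tendsto_of_tendsto ((hg a ha).dist (hg b hb)) (hcu.mul_const (dist a b)) ?_
    filter_upwards [hmem] with y hy using (hfL y hy).dist_le_mul a ha b hb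
  have hg0 : g 0 = x := tendsto_nhds_unique (hg 0 hm0) <|
    Tendsto.congr' (by filter_upwards [hmem] with y hy using (hf0 y hy).symm) (tendsto_id'.2 hu)
  have hg1 : g 1 = q := tendsto_nhds_unique (hg 1 hm1) <|
    Tendsto.congr' (by filter_upwards [hmem] with y hy using (hf1 y hy).symm) tendsto_const_nhds
  have hgS : ∀ t ∈ Set.Icc (0 : ℝ) 1, g t ∉ S := fun t ht =>
    hS.isClosed_compl.mem_of_tendsto (hg t ht)
      (by filter_upwards [hmem] with y hy using hfS y hy t ht)
  exact (dCompl_le_of_lipschitzOnWith hg0 hg1 hL hgS).trans (ENNReal.coe_add _ _).le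

/-- Lemma 2.3.  The sets `Ω_n` are open. -/
theorem omegaSeq_isOpen
    {M : Type*} [MetricSpace M] [ProperSpace M] (hM : IsLengthSpace M)
    (p q : M) (hpq : p ≠ q) (lam : ℝ) (hlam : 1 < lam) :
    ∀ n : ℕ, IsOpen (OmegaSeq p q lam n) := by
  intro n
  induction n with
  | zero => exact isOpen_empty
  | succ n ih =>
    have hc : Continuous fun x : M => Real.toNNReal (lam * dist x p) := by fun_prop
    rw [← isClosed_compl_iff]
    convert isClosed_setOf_dCompl_le ih q hc using 1
    ext x
    simp only [OmegaSeq, Set.mem_compl_iff, Set.mem_union, Set.mem_ofPred_eq, not_or, not_and,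
      not_lt, ENNReal.ofReal]
    tauto

end GrowthComp
end
end

section
/- For every n ≥ 0: d_{Ω_n}(x,q) ≥ λ d(x,p) for all x in the topological boundary ∂Ω_n, and d_{Ω_n}(x,q) = λ d(x,p) for all x in the topological boundary ∂Ω_{n+1}. -/
/-!
Formalization framework for "growth competitions" (after the paper's
Section 2), at the metric-space level.

Since Mathlib does not yet have Riemannian metrics, a complete Riemannian
manifold is represented by a proper (hence complete; Hopf-Rinow) metric
space whose distance is the induced length (intrinsic) metric, and
spherical symmetry about `p` with warping function `G` is expressed through
global geodesic polar normal coordinates `Φ : ℝⁿ ≃ M` with `Φ 0 = p` and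
`dist (Φ x) p = ‖x‖`, in which the Riemannian distance is the infimum of
lengths of Lipschitz curves measured in the warped metric
`g = dr² + G(r)² dθ²`.
-/

open Set Metric Filter MeasureTheory InnerProductGeometry NNReal ENNReal
open scoped RealInnerProductSpace Classical

noncomputable section

namespace GrowthComp

variable {M : Type*} [MetricSpace M]

/-- `x` and `y` are joined by a `1`-Lipschitz path avoiding `S`, parametrized on `[0, L]`. -/
def JoinedAvoiding (S : Set M) (x y : M) (L : ℝ) : Prop :=
  0 ≤ L ∧ ∃ γ : ℝ → M, LipschitzWith 1 γ ∧ γ 0 = x ∧ γ L = y ∧ ∀ t ∈ Icc 0 L, γ t ∉ S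

theorem _root_.LipschitzOnWith.eVariationOn_inter_Icc_le {γ : ℝ → M} {K : ℝ≥0} {s : Set ℝ}
    (hγ : LipschitzOnWith K γ s) {a b : ℝ} (ha : a ∈ s) (hb : b ∈ s) :
    eVariationOn γ (s ∩ Icc a b) ≤ K * ENNReal.ofReal (b - a) :=
  (hγ.comp_eVariationOn_le (g := id) (s := s ∩ Icc a b) fun _ h => h.1).trans
    (mul_le_mul_right ((monotone_id.monotoneOn s).eVariationOn_eq ha hb).le _)

theorem _root_.LipschitzOnWith.lipschitzOnWith_variationOnFromTo {γ : ℝ → M} {K : ℝ≥0} {s : Set ℝ}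
    (hγ : LipschitzOnWith K γ s) {a : ℝ} (ha : a ∈ s) :
    LipschitzOnWith K (variationOnFromTo γ s a) s := by
  have hbv := hγ.locallyBoundedVariationOn
  refine LipschitzOnWith.of_le_add_mul K fun b hb c hc => ?_
  have hadd := variationOnFromTo.add hbv ha hc hb
  rcases le_total b c with hbc | hcb
  · have := variationOnFromTo.monotoneOn hbv ha hb hc hbc
    have : (0 : ℝ) ≤ K * dist b c := by positivity
    linarith
  · rw [← hadd, variationOnFromTo.eq_of_le _ _ hcb, Real.dist_eq, abs_of_nonneg (by linarith)]
    gcongr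
    refine ENNReal.toReal_le_of_le_ofReal (mul_nonneg K.coe_nonneg (by linarith)) ?_
    rw [ENNReal.ofReal_mul K.coe_nonneg, ENNReal.ofReal_coe_nnreal]
    exact hγ.eVariationOn_inter_Icc_le hc hb

namespace JoinedAvoiding

variable {S : Set M} {x y z : M} {L L₁ L₂ : ℝ}

theorem of_lipschitzOnWith (hL : 0 ≤ L) {γ : ℝ → M} (hγ : LipschitzOnWith 1 γ (Icc 0 L))
    (h0 : γ 0 = x) (h1 : γ L = y) (hS : ∀ t ∈ Icc 0 L, γ t ∉ S) : JoinedAvoiding S x y L := by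
  refine ⟨hL, fun t => γ (projIcc 0 L hL t), ?_, ?_, ?_, fun t _ => hS _ (projIcc 0 L hL t).2⟩
  · simpa [Function.comp_def] using
      hγ.to_restrict.comp (LipschitzWith.projIcc hL)
  · simpa using h0
  · simpa using h1

theorem trans (h₁ : JoinedAvoiding S x y L₁) (h₂ : JoinedAvoiding S y z L₂) :
    JoinedAvoiding S x z (L₁ + L₂) := by
  obtain ⟨hL₁, γ₁, hγ₁, h10, h1L, hS₁⟩ := h₁
  obtain ⟨hL₂, γ₂, hγ₂, h20, h2L, hS₂⟩ := h₂
  have key : ∀ s t, s ≤ L₁ → L₁ < t → dist (γ₁ s) (γ₂ (t - L₁)) ≤ |s - t| := by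
    intro s t hs ht
    have e1 := hγ₁.dist_le_mul s L₁
    have e2 := hγ₂.dist_le_mul 0 (t - L₁)
    have e3 := dist_triangle (γ₁ s) (γ₁ L₁) (γ₂ (t - L₁))
    rw [h1L, ← h20] at e3
    rw [h1L, ← h20, NNReal.coe_one, one_mul, Real.dist_eq, abs_of_nonpos (by linarith)] at e1
    rw [NNReal.coe_one, one_mul, Real.dist_eq, abs_of_nonpos (by linarith)] at e2
    rw [abs_of_nonpos (by linarith)]
    linarith
  refine ⟨by linarith, fun t => if t ≤ L₁ then γ₁ t else γ₂ (t - L₁), ?_, ?_, ?_, ?_⟩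
  · refine LipschitzWith.of_dist_le_mul fun s t => ?_
    rw [NNReal.coe_one, one_mul, Real.dist_eq]
    by_cases hs : s ≤ L₁ <;> by_cases ht : t ≤ L₁ <;> simp only [hs, ht, if_true, if_false]
    · simpa [Real.dist_eq] using hγ₁.dist_le_mul s t
    · exact key s t hs (not_le.1 ht)
    · rw [dist_comm, abs_sub_comm]
      exact key t s ht (not_le.1 hs)
    · simpa [Real.dist_eq] using hγ₂.dist_le_mul (s - L₁) (t - L₁)
  · simp [hL₁, h10]
  · rcases hL₂.eq_or_lt with rfl | h
    · simp [h1L, ← h20, h2L]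
    · simp [h.not_ge, h2L]
  · rintro t ⟨ht0, htL⟩
    by_cases ht : t ≤ L₁
    · simpa [ht] using hS₁ t ⟨ht0, ht⟩
    · simpa [ht] using hS₂ (t - L₁) ⟨by linarith, by linarith⟩

theorem avoiding_of_disjoint_ball {r : ℝ} (h : JoinedAvoiding ∅ x y L) (hLr : L < r)
    (hS : Disjoint (ball y r) S) : JoinedAvoiding S x y L := by
  obtain ⟨hL, γ, hγ, h0, h1, -⟩ := h
  refine ⟨hL, γ, hγ, h0, h1, fun t ht => disjoint_left.1 hS ?_⟩
  have := hγ.dist_le_mul t L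
  rw [h1, NNReal.coe_one, one_mul, Real.dist_eq, abs_of_nonpos (by linarith [ht.2])] at this
  rw [mem_ball]
  linarith [ht.1]

theorem mono (h : JoinedAvoiding S x y L₁) (hL : L₁ ≤ L₂) : JoinedAvoiding S x y L₂ := by
  obtain ⟨h0, γ, -, -, hy, hS⟩ := id h
  have hconst : JoinedAvoiding S y y (L₂ - L₁) :=
    ⟨sub_nonneg.2 hL, fun _ => y, LipschitzWith.const' y, rfl, rfl,
      fun _ _ => hy ▸ hS L₁ ⟨h0, le_rfl⟩⟩
  simpa using h.trans hconst

theorem dCompl_le (h : JoinedAvoiding S x y L) : dCompl S x y ≤ ENNReal.ofReal L := by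
  obtain ⟨hL, γ, hγ, h0, h1, hS⟩ := h
  refine le_trans (sInf_le ⟨L, γ, hL, h0, h1, ⟨1, hγ.lipschitzOnWith⟩, hS, rfl⟩) ?_
  have := (hγ.lipschitzOnWith (s := Icc 0 L)).eVariationOn_inter_Icc_le
    (left_mem_Icc.2 hL) (right_mem_Icc.2 hL)
  simpa [pathLength] using this

end JoinedAvoiding

theorem joinedAvoiding_of_dCompl_lt {S : Set M} {x y : M} {L : ℝ}
    (h : dCompl S x y < ENNReal.ofReal L) : JoinedAvoiding S x y L := by
  obtain ⟨_, ⟨T, γ, hT, h0, h1, ⟨K, hγ⟩, hS, rfl⟩, hlt⟩ := sInf_lt_iff.1 h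
  have hbv := hγ.locallyBoundedVariationOn
  have m0 : (0 : ℝ) ∈ Icc 0 T := left_mem_Icc.2 hT
  have mT : T ∈ Icc 0 T := right_mem_Icc.2 hT
  set V := variationOnFromTo γ (Icc 0 T) 0 with hV
  set η := naturalParameterization γ (Icc 0 T) 0
  have hV0 : V 0 = 0 := variationOnFromTo.self _ _ _
  have hVT : V T = (pathLength γ T).toReal := by
    rw [hV, variationOnFromTo.eq_of_le _ _ hT, inter_self, pathLength]
  have hsurj : Icc 0 (V T) ⊆ V '' Icc 0 T := by
    simpa only [← hV, hV0] using
      intermediate_value_Icc hT (hγ.lipschitzOnWith_variationOnFromTo m0).continuousOn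
  have hηV : ∀ t ∈ Icc 0 T, η (V t) = γ t := fun t ht =>
    edist_eq_zero.1 (edist_naturalParameterization_eq_zero hbv m0 ht)
  have hspeed := has_unit_speed_naturalParameterization γ hbv m0
  have hlen : V T ≤ L := by
    rw [hVT]
    have hL : 0 < L := ENNReal.ofReal_pos.1 (bot_le.trans_lt hlt)
    exact ENNReal.toReal_le_of_le_ofReal hL.le hlt.le
  refine JoinedAvoiding.mono ?_ hlen
  have hVT0 : 0 ≤ V T := hVT ▸ ENNReal.toReal_nonneg
  refine JoinedAvoiding.of_lipschitzOnWith hVT0 (γ := η) ?_ ?_ ?_ ?_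
  · have key : ∀ s ∈ Icc 0 (V T), ∀ t ∈ Icc 0 (V T), s ≤ t →
        edist (η s) (η t) ≤ edist s t := by
      intro s hs t ht hst
      have hs' := hsurj hs
      have ht' := hsurj ht
      refine (eVariationOn.edist_le η (s := V '' Icc 0 T ∩ Icc s t)
        ⟨hs', le_rfl, hst⟩ ⟨ht', hst, le_rfl⟩).trans ?_
      rw [hspeed hs' ht', edist_comm, edist_dist, Real.dist_eq, abs_of_nonneg (by linarith)]
      simp
    intro s hs t ht
    rw [ENNReal.coe_one, one_mul]
    rcases le_total s t with hst | hst
    · exact key s hs t ht hst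
    · rw [edist_comm, edist_comm s]
      exact key t ht s hs hst
  · rw [← hV0, hηV 0 m0, h0]
  · rw [hηV T mT, h1]
  · intro t ht
    obtain ⟨s, hs, rfl⟩ := hsurj ht
    rw [hηV s hs]
    exact hS s hs

/-- A limit, in the starting point, of `1`-Lipschitz paths of bounded length avoiding an open set
is again such a path. -/
theorem JoinedAvoiding.of_mem_closure [ProperSpace M] {S : Set M} (hS : IsOpen S) {x q : M} {L : ℝ}
    (h : x ∈ closure {y | JoinedAvoiding S y q L}) : JoinedAvoiding S x q L := by
  obtain ⟨u, hu, hux⟩ := mem_closure_iff_ultrafilter.1 h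
  have hL : 0 ≤ L := (u.nonempty_of_mem hu).some_mem.1
  choose! γ hγ h0 h1 havoid using fun y (hy : JoinedAvoiding S y q L) => hy.2
  have hlim : ∀ t, ∃ z, Tendsto (fun y => γ y t) u (nhds z) := by
    intro t
    obtain ⟨z, -, hz⟩ := (isCompact_closedBall q |t - L|).ultrafilter_le_nhds'
      (u.map fun y => γ y t) (by
        refine Ultrafilter.mem_map.2 (Filter.mem_of_superset hu fun y hy => ?_)
        have := (hγ y hy).dist_le_mul t L
        rwa [h1 y hy, NNReal.coe_one, one_mul, Real.dist_eq] at this)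
    exact ⟨z, hz⟩
  choose η hη using hlim
  refine ⟨hL, η, ?_, ?_, ?_, ?_⟩
  · refine LipschitzWith.of_dist_le_mul fun s t => ?_
    exact le_of_tendsto ((hη s).dist (hη t))
      (Filter.mem_of_superset hu fun y hy => (hγ y hy).dist_le_mul s t)
  · refine tendsto_nhds_unique (hη 0) (Tendsto.congr' ?_ (tendsto_id'.2 hux))
    exact Filter.mem_of_superset hu fun y hy => (h0 y hy).symm
  · refine tendsto_nhds_unique (hη L) (Tendsto.congr' ?_ tendsto_const_nhds)
    exact Filter.mem_of_superset hu fun y hy => (h1 y hy).symm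
  · intro t ht
    exact hS.isClosed_compl.mem_of_tendsto (hη t)
      (Filter.mem_of_superset hu fun y hy => havoid y hy t ht)

/-- The sublevel sets `{d_S(·, q) ≤ f}` are closed when `S` is open and `f` is continuous. -/
theorem isClosed_dCompl_le [ProperSpace M] {S : Set M} (hS : IsOpen S) (q : M) {f : M → ℝ}
    (hf : Continuous f) (hf0 : ∀ x, 0 ≤ f x) :
    IsClosed {x | x ∉ S ∧ dCompl S x q ≤ ENNReal.ofReal (f x)} := by
  refine isClosed_of_closure_subset fun x hx => ?_
  refine ⟨hS.isClosed_compl.closure_subset_iff.2 (fun y hy => hy.1) hx, ?_⟩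
  refine ENNReal.le_of_forall_pos_le_add fun ε hε _ => ?_
  rw [← ENNReal.ofReal_coe_nnreal, ← ENNReal.ofReal_add (hf0 x) ε.coe_nonneg]
  refine (JoinedAvoiding.of_mem_closure hS ?_).dCompl_le
  have hnear : ∀ᶠ y in nhds x, f y < f x + ε :=
    hf.continuousAt.eventually_lt_const (lt_add_of_pos_right _ (by exact_mod_cast hε))
  refine mem_closure_iff_frequently.2
    (((mem_closure_iff_frequently.1 hx).and_eventually hnear).mono fun y hy => ?_)
  exact joinedAvoiding_of_dCompl_lt (hy.1.2.trans_lt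
    ((ENNReal.ofReal_lt_ofReal_iff_of_nonneg (hf0 y)).2 hy.2))

theorem dCompl_mono {S S' : Set M} (h : S ⊆ S') (x y : M) : dCompl S x y ≤ dCompl S' x y := by
  refine sInf_le_sInf ?_
  rintro _ ⟨T, γ, hT, h0, h1, hγ, hS, rfl⟩
  exact ⟨T, γ, hT, h0, h1, hγ, fun t ht hmem => hS t ht (h hmem), rfl⟩

theorem compl_omegaSeq_succ (p q : M) (lam : ℝ) (n : ℕ) :
    (OmegaSeq p q lam (n + 1))ᶜ = {x | x ∉ OmegaSeq p q lam n ∧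
      dCompl (OmegaSeq p q lam n) x q ≤ ENNReal.ofReal (lam * dist x p)} := by
  ext x
  simp only [OmegaSeq, mem_compl_iff, mem_union, mem_ofPred_eq, not_or, not_and, not_lt]
  exact and_congr_right fun h => ⟨fun h' => h' h, fun h' _ => h'⟩

theorem isOpen_omegaSeq [ProperSpace M] (p q : M) {lam : ℝ} (hlam : 0 ≤ lam) (n : ℕ) :
    IsOpen (OmegaSeq p q lam n) := by
  induction n with
  | zero => exact isOpen_empty
  | succ n ih =>
    rw [← isClosed_compl_iff, compl_omegaSeq_succ]
    exact isClosed_dCompl_le ih q (by fun_prop) fun x => by positivity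

/-- Off the closure of an obstacle `S`, strict upper bounds on `d_S(·, q)` are open conditions. -/
theorem eventually_dCompl_le (hM : IsLengthSpace M) {S : Set M} {x q : M} (hx : x ∉ closure S)
    {f : M → ℝ} (hf : ContinuousAt f x) (h : dCompl S x q < ENNReal.ofReal (f x)) :
    ∀ᶠ y in nhds x, y ∉ S ∧ dCompl S y q ≤ ENNReal.ofReal (f y) := by
  obtain ⟨l, hl, hlf⟩ := ENNReal.lt_iff_exists_nnreal_btwn.1 h
  rw [← ENNReal.ofReal_coe_nnreal] at hl hlf
  have hlf : (l : ℝ) < f x := (ENNReal.ofReal_lt_ofReal_iff_of_nonneg l.coe_nonneg).1 hlf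
  have hxq := joinedAvoiding_of_dCompl_lt hl
  obtain ⟨r, hr, hball⟩ := Metric.mem_nhds_iff.1 (isClosed_closure.isOpen_compl.mem_nhds hx)
  have hdisj : Disjoint (ball x r) S :=
    disjoint_left.2 fun y hy hyS => hball hy (subset_closure hyS)
  set δ := min (r / 2) ((f x - l) / 2)
  have hδ0 : 0 < δ := lt_min (by linarith) (by linarith)
  have hδr : δ < r := (min_le_left _ _).trans_lt (by linarith)
  have hδf : l + δ < f x := by linarith [min_le_right (r / 2) ((f x - l) / 2)]
  filter_upwards [ball_mem_nhds x hδ0, hf.eventually_const_lt hδf] with y hy hfy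
  refine ⟨disjoint_left.1 hdisj (ball_subset_ball hδr.le hy), ?_⟩
  have hyx : JoinedAvoiding ∅ y x δ :=
    joinedAvoiding_of_dCompl_lt (hM y x ▸ (ENNReal.ofReal_lt_ofReal_iff hδ0).2 hy)
  refine ((hyx.avoiding_of_disjoint_ball hδr hdisj).trans hxq).dCompl_le.trans ?_
  exact ENNReal.ofReal_le_ofReal (by linarith)

theorem dCompl_eq_of_mem_frontier_succ [ProperSpace M] (hM : IsLengthSpace M) (p q : M) {lam : ℝ}
    (hlam : 0 ≤ lam) {n : ℕ}
    (h : ∀ x ∈ frontier (OmegaSeq p q lam n),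
      ENNReal.ofReal (lam * dist x p) ≤ dCompl (OmegaSeq p q lam n) x q)
    {x : M} (hx : x ∈ frontier (OmegaSeq p q lam (n + 1))) :
    dCompl (OmegaSeq p q lam n) x q = ENNReal.ofReal (lam * dist x p) := by
  rw [(isOpen_omegaSeq p q hlam _).frontier_eq] at hx
  obtain ⟨hxS, hxle⟩ := (compl_omegaSeq_succ p q lam n).subset hx.2
  refine le_antisymm hxle ?_
  by_cases hcl : x ∈ closure (OmegaSeq p q lam n)
  · exact h x ((isOpen_omegaSeq p q hlam n).frontier_eq ▸ ⟨hcl, hxS⟩)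
  · by_contra! hlt
    have hf : ContinuousAt (fun y => lam * dist y p) x := by fun_prop
    obtain ⟨y, hy, hy'⟩ := ((mem_closure_iff_frequently.1 hx.1).and_eventually
      (eventually_dCompl_le hM hcl hf hlt)).exists
    exact (compl_omegaSeq_succ p q lam n).superset hy' hy

/-- Lemma 2.4.  For every `n ≥ 0`:
`d_{Ω_n}(x,q) ≥ λ d(x,p)` for all `x ∈ ∂Ω_n`, and
`d_{Ω_n}(x,q) = λ d(x,p)` for all `x ∈ ∂Ω_{n+1}`. -/
theorem omegaSeq_boundary_eq
    {M : Type*} [MetricSpace M] [ProperSpace M] (hM : IsLengthSpace M)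
    (p q : M) (hpq : p ≠ q) (lam : ℝ) (hlam : 1 < lam) :
    ∀ n : ℕ,
      (∀ x ∈ frontier (OmegaSeq p q lam n),
        ENNReal.ofReal (lam * dist x p) ≤ dCompl (OmegaSeq p q lam n) x q) ∧
      (∀ x ∈ frontier (OmegaSeq p q lam (n + 1)),
        dCompl (OmegaSeq p q lam n) x q = ENNReal.ofReal (lam * dist x p)) := by
  have hlam0 : 0 ≤ lam := by linarith
  have lower : ∀ n : ℕ, ∀ x ∈ frontier (OmegaSeq p q lam n),
      ENNReal.ofReal (lam * dist x p) ≤ dCompl (OmegaSeq p q lam n) x q := by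
    intro n
    induction n with
    | zero => simp [OmegaSeq]
    | succ n ih =>
      intro x hx
      rw [← dCompl_eq_of_mem_frontier_succ hM p q hlam0 ih hx]
      exact dCompl_mono subset_union_left x q
  exact fun n => ⟨lower n, fun x hx => dCompl_eq_of_mem_frontier_succ hM p q hlam0 (lower n) hx⟩

end GrowthComp
end
end

section
/- For every n ≥ 0, the set Ω_n is star-shaped about p; consequently Ω = ⋃_{n≥1} Ω_n is star-shaped about p. -/
/-!
Formalization framework for "growth competitions" (after the paper's
Section 2), at the metric-space level.

Since Mathlib does not yet have Riemannian metrics, a complete Riemannian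
manifold is represented by a proper (hence complete; Hopf-Rinow) metric
space whose distance is the induced length (intrinsic) metric, and
spherical symmetry about `p` with warping function `G` is expressed through
global geodesic polar normal coordinates `Φ : ℝⁿ ≃ M` with `Φ 0 = p` and
`dist (Φ x) p = ‖x‖`, in which the Riemannian distance is the infimum of
lengths of Lipschitz curves measured in the warped metric
`g = dr² + G(r)² dθ²`.
-/

open Set Metric Filter MeasureTheory InnerProductGeometry NNReal ENNReal
open scoped RealInnerProductSpace Classical

noncomputable section

namespace GrowthComp

variable {M : Type*} [MetricSpace M]

lemma IsMinGeodesicFromTo.dist_left_eq {M : Type*} [MetricSpace M] {γ : ℝ → M} {x y : M}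
    (h : IsMinGeodesicFromTo γ x y) {t : ℝ} (ht : t ∈ Set.Icc (0 : ℝ) (dist x y)) :
    dist x (γ t) = t := by
  have := h.2.2 0 ⟨le_rfl, dist_nonneg⟩ t ht
  rwa [h.1, zero_sub, abs_neg, abs_of_nonneg ht.1] at this

/-- A minimizing geodesic from `x` restricts to a minimizing geodesic from `x` to each of
its points. -/
lemma IsMinGeodesicFromTo.restrict {M : Type*} [MetricSpace M] {γ : ℝ → M} {x y : M}
    (h : IsMinGeodesicFromTo γ x y) {t : ℝ} (ht : t ∈ Set.Icc (0 : ℝ) (dist x y)) :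
    IsMinGeodesicFromTo γ x (γ t) := by
  unfold IsMinGeodesicFromTo
  rw [h.dist_left_eq ht]
  exact ⟨h.1, rfl, fun s hs u hu =>
    h.2.2 s ⟨hs.1, hs.2.trans ht.2⟩ u ⟨hu.1, hu.2.trans ht.2⟩⟩

/-- Two Lipschitz pieces on adjacent intervals form a Lipschitz function. -/
lemma lipschitzOnWith_Icc_union {M : Type*} [PseudoMetricSpace M] {f : ℝ → M}
    {a b c : ℝ} {K : ℝ≥0} (hab : a ≤ b) (hbc : b ≤ c)
    (h₁ : LipschitzOnWith K f (Set.Icc a b)) (h₂ : LipschitzOnWith K f (Set.Icc b c)) :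
    LipschitzOnWith K f (Set.Icc a c) := by
  have key : ∀ s ∈ Set.Icc a c, ∀ u ∈ Set.Icc a c, s ≤ u →
      dist (f s) (f u) ≤ K * dist s u := by
    intro s hs u hu hsu
    rcases le_total u b with hub | hub
    · exact h₁.dist_le_mul s ⟨hs.1, hsu.trans hub⟩ u ⟨hu.1, hub⟩
    rcases le_total b s with hbs | hbs
    · exact h₂.dist_le_mul s ⟨hbs, hs.2⟩ u ⟨hub, hu.2⟩
    have e₁ := h₁.dist_le_mul s ⟨hs.1, hbs⟩ b ⟨hab, le_rfl⟩
    have e₂ := h₂.dist_le_mul b ⟨le_rfl, hbc⟩ u ⟨hub, hu.2⟩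
    have e₃ : dist s u = dist s b + dist b u := by
      simp only [Real.dist_eq, abs_sub_comm s, abs_sub_comm b u]
      rw [abs_of_nonneg (by linarith), abs_of_nonneg (by linarith),
        abs_of_nonneg (by linarith)]
      ring
    calc dist (f s) (f u) ≤ dist (f s) (f b) + dist (f b) (f u) := dist_triangle _ _ _
      _ ≤ K * dist s b + K * dist b u := add_le_add e₁ e₂
      _ = K * dist s u := by rw [e₃]; ring
  refine LipschitzOnWith.of_dist_le_mul fun s hs u hu => ?_
  rcases le_total s u with h | h
  · exact key s hs u hu h
  · rw [dist_comm, dist_comm s]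
    exact key u hu s hs h

/-- Prepending a `1`-Lipschitz path of duration `a` increases the intrinsic distance in the
complement of `S` by at most `a`. -/
lemma dCompl_le_add {M : Type*} [MetricSpace M] {S : Set M} {x y : M} (z : M) {a : ℝ}
    (ha : 0 ≤ a) {σ : ℝ → M} (hσ₀ : σ 0 = x) (hσa : σ a = y)
    (hσ : LipschitzOnWith 1 σ (Set.Icc 0 a)) (hσS : ∀ t ∈ Set.Icc 0 a, σ t ∉ S) :
    dCompl S x z ≤ ENNReal.ofReal a + dCompl S y z := by
  rw [← tsub_le_iff_left]
  refine le_sInf ?_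
  rintro _ ⟨T, η, hT, hη₀, hηT, ⟨K, hη⟩, hηS, rfl⟩
  rw [tsub_le_iff_left]
  set f : ℝ → M := fun s => if s ≤ a then σ s else η (s - a) with hf
  have hf₁ : Set.EqOn f σ (Set.Icc 0 a) := fun s hs => if_pos hs.2
  have hf₂ : Set.EqOn f (η ∘ fun s => s - a) (Set.Icc a (a + T)) := by
    intro s hs
    rcases hs.1.eq_or_lt with rfl | h
    · simp [hf, hσa, hη₀]
    · exact if_neg h.not_ge
  have hmaps : Set.MapsTo (fun s => s - a) (Set.Icc a (a + T)) (Set.Icc 0 T) :=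
    fun s hs => ⟨by linarith [hs.1], by linarith [hs.2]⟩
  have haT : a ≤ a + T := by linarith
  have hL₁ : LipschitzOnWith (max 1 K) f (Set.Icc 0 a) := by
    intro s hs u hu
    rw [hf₁ hs, hf₁ hu]
    exact (hσ.weaken (le_max_left _ _)) hs hu
  have hL₂ : LipschitzOnWith (max 1 K) f (Set.Icc a (a + T)) := by
    intro s hs u hu
    rw [hf₂ hs, hf₂ hu]
    simpa using (hη.weaken (le_max_right 1 K)) (hmaps hs) (hmaps hu)
  have hmem : dCompl S x z ≤ pathLength f (a + T) := by
    refine sInf_le ⟨a + T, f, by linarith, ?_, ?_,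
      ⟨_, lipschitzOnWith_Icc_union ha haT hL₁ hL₂⟩, ?_, rfl⟩
    · rw [hf₁ ⟨le_rfl, ha⟩, hσ₀]
    · rw [hf₂ ⟨haT, le_rfl⟩]
      simp [hηT]
    · intro t ht
      rcases le_total t a with h | h
      · rw [hf₁ ⟨ht.1, h⟩]
        exact hσS t ⟨ht.1, h⟩
      · rw [hf₂ ⟨h, ht.2⟩]
        exact hηS _ (hmaps ⟨h, ht.2⟩)
  have hsplit : pathLength f (a + T) =
      eVariationOn f (Set.Icc 0 a) + eVariationOn f (Set.Icc a (a + T)) := by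
    have := eVariationOn.Icc_add_Icc f (s := Set.univ) ha haT (Set.mem_univ a)
    simpa [pathLength] using this.symm
  have hv₁ : eVariationOn f (Set.Icc 0 a) ≤ ENNReal.ofReal a := by
    rw [eVariationOn.eq_of_eqOn hf₁]
    have h := hσ.comp_eVariationOn_le (f := σ) (g := id) (s := Set.Icc 0 a)
      (Set.mapsTo_id _)
    have h' := (monotone_id.monotoneOn (Set.univ : Set ℝ)).eVariationOn_eq
      (Set.mem_univ 0) (Set.mem_univ a)
    simp only [Set.univ_inter, id, sub_zero] at h'
    simp only [Function.comp_id, ENNReal.coe_one, one_mul] at h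
    exact h.trans h'.le
  have hv₂ : eVariationOn f (Set.Icc a (a + T)) ≤ pathLength η T := by
    rw [eVariationOn.eq_of_eqOn hf₂]
    exact eVariationOn.comp_le_of_monotoneOn η _
      (fun s _ u _ hsu => by simpa using hsu) hmaps
  calc dCompl S x z ≤ pathLength f (a + T) := hmem
    _ ≤ ENNReal.ofReal a + pathLength η T := hsplit ▸ add_le_add hv₁ hv₂

/-- One step of the recursion defining `Ω_n` preserves star-shapedness. -/
lemma StarShapedAbout.union_dCompl_gt {M : Type*} [MetricSpace M] {p : M} {S : Set M}
    (hS : StarShapedAbout p S) (q : M) {lam : ℝ} (hlam : 1 ≤ lam) :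
    StarShapedAbout p
      (S ∪ {x | x ∉ S ∧ ENNReal.ofReal (lam * dist x p) < dCompl S x q}) := by
  rintro x (hx | ⟨-, hx⟩) γ hγ t ht
  · exact Or.inl (hS x hx γ hγ t ht)
  by_cases hy : γ t ∈ S
  · exact Or.inl hy
  refine Or.inr ⟨hy, ?_⟩
  by_contra! hle
  refine hx.not_ge ?_
  rw [dist_comm, hγ.dist_left_eq ht] at hle
  rw [dist_comm]
  have havoid : ∀ s ∈ Set.Icc (0 : ℝ) (dist p x - t), γ (dist p x - s) ∉ S := by
    intro s hs hmem
    have hs' : dist p x - s ∈ Set.Icc (0 : ℝ) (dist p x) :=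
      ⟨by linarith [hs.2, ht.1], by linarith [hs.1]⟩
    refine hy (hS _ hmem γ (hγ.restrict hs') t ?_)
    rw [hγ.dist_left_eq hs']
    exact ⟨ht.1, by linarith [hs.2]⟩
  have hlip : LipschitzOnWith 1 (fun s => γ (dist p x - s))
      (Set.Icc 0 (dist p x - t)) := by
    refine LipschitzOnWith.of_dist_le_mul fun s hs u hu => ?_
    rw [hγ.2.2 _ ⟨by linarith [hs.2, ht.1], by linarith [hs.1]⟩ _
      ⟨by linarith [hu.2, ht.1], by linarith [hu.1]⟩, Real.dist_eq, abs_sub_comm s]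
    simp
  calc dCompl S x q ≤ ENNReal.ofReal (dist p x - t) + dCompl S (γ t) q :=
        dCompl_le_add q (sub_nonneg.2 ht.2) (by simpa using hγ.2.1) (by simp) hlip havoid
    _ ≤ ENNReal.ofReal (dist p x - t) + ENNReal.ofReal (lam * t) := by gcongr
    _ = ENNReal.ofReal (dist p x - t + lam * t) :=
        (ENNReal.ofReal_add (sub_nonneg.2 ht.2)
          (mul_nonneg (zero_le_one.trans hlam) ht.1)).symm
    _ ≤ ENNReal.ofReal (lam * dist p x) := by
        refine ENNReal.ofReal_le_ofReal ?_
        nlinarith [mul_nonneg (sub_nonneg.2 hlam) (sub_nonneg.2 ht.2)]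

/-- Lemma 2.5.  Each `Ω_n` is star-shaped about `p`; thus
`Ω = ⋃_{n ≥ 1} Ω_n` is star-shaped about `p`. -/
theorem omegaSeq_starShaped
    {M : Type*} [MetricSpace M] [ProperSpace M] (hM : IsLengthSpace M)
    (p q : M) (hpq : p ≠ q) (lam : ℝ) (hlam : 1 < lam) :
    (∀ n : ℕ, StarShapedAbout p (OmegaSeq p q lam n)) ∧
      StarShapedAbout p (Omega p q lam) := by
  have h : ∀ n : ℕ, StarShapedAbout p (OmegaSeq p q lam n) := by
    intro n
    induction n with
    | zero => exact fun x hx => hx.elim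
    | succ n ih => exact ih.union_dCompl_gt q hlam.le
  refine ⟨h, fun x hx γ hγ t ht => ?_⟩
  obtain ⟨n, hn⟩ := Set.mem_iUnion.1 hx
  exact Set.mem_iUnion.2 ⟨n, h (n + 1) x hn γ hγ t ht⟩

end GrowthComp
end
end
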